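/- arXiv:2007.09017 — 4 statements merged into one kernel-verified Lean document; each statement's English description precedes it below -/
import Mathlib

section
/- Let 𝒞 be a set of continuous cost functions (each of the form c : ℝ_{≥0}^m → ℝ^m for some m ∈ ℕ) that is closed under composition. Then 𝒞 is consistent for weighted resource graph games if and only if one of the following holds: (1) for each c ∈ 𝒞 with c : ℝ_{≥0}^m → ℝ^m there exist a symmetric matrix A ∈ ℝ^{m×m} and a vector b ∈ ℝ^m such that c(x) = A x + b; or (2) there exists φ ∈ ℝ such that for each c ∈ 𝒞 with c : ℝ_{≥0}^m → ℝ^m there exist a, b ∈ ℝ^m such that c_r(x) = a_r exp(φ x_r) + b_r for all r ∈ {1,…,m} and all x ∈ ℝ_{≥0}^m. -/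
open Finset NNReal

/-- The indicator vector of a set `S` of resources, as a vector of nonnegative reals. -/
def nindicVec {m : ℕ} (S : Finset (Fin m)) : Fin m → NNReal :=
  fun r => if r ∈ S then 1 else 0

/-- The load vector induced by weights `w` and a profile `y` of `0/1`-vectors. -/
def wloadVec {n m : ℕ} (w : Fin n → NNReal) (y : Fin n → Fin m → ℕ) : Fin m → NNReal :=
  fun r => ∑ i, w i * (y i r : NNReal)

/-- The private cost of player `i` in the weighted resource graph game. -/
noncomputable def wPlayerCost {n m : ℕ} (c : (Fin m → NNReal) → Fin m → ℝ)
    (w : Fin n → NNReal) (y : Fin n → Fin m → ℕ) (i : Fin n) : ℝ :=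
  ∑ r, ((w i : ℝ) * (y i r : ℝ)) * c (wloadVec w y) r

/-- `Y` is a valid system of strategy sets: each `Y i` is a nonempty
finite set of `0/1`-vectors. -/
def IsStrategySets {n m : ℕ} (Y : Fin n → Finset (Fin m → ℕ)) : Prop :=
  (∀ i, (Y i).Nonempty) ∧ ∀ i, ∀ v ∈ Y i, ∀ r, v r ≤ 1

/-- `y` is a pure Nash equilibrium of the weighted resource graph game with
weights `w`, strategy sets `Y`, and cost function `c`. -/
def IsWPNE {n m : ℕ} (c : (Fin m → NNReal) → Fin m → ℝ) (w : Fin n → NNReal)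
    (Y : Fin n → Finset (Fin m → ℕ)) (y : Fin n → Fin m → ℕ) : Prop :=
  (∀ i, y i ∈ Y i) ∧
    ∀ i, ∀ y' ∈ Y i,
      wPlayerCost c w y i ≤ wPlayerCost c w (Function.update y i y') i

/-- The composition `c ⊕ c'` of two cost functions. -/
def woplus {m m' : ℕ} (c : (Fin m → NNReal) → Fin m → ℝ)
    (c' : (Fin m' → NNReal) → Fin m' → ℝ) :
    (Fin (m + m') → NNReal) → Fin (m + m') → ℝ :=
  fun x => Fin.addCases (motive := fun _ => ℝ)
    (fun i => c (fun j => x (Fin.castAdd m' j)) i)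
    (fun i => c' (fun j => x (Fin.natAdd m j)) i)

/-- A set of cost functions on the nonnegative orthant, one set for each number
`m` of resources. -/
abbrev WCostFamily := (m : ℕ) → Set ((Fin m → NNReal) → Fin m → ℝ)

/-- `𝒞` is closed under composition. -/
def WClosedUnderComposition (𝒞 : WCostFamily) : Prop :=
  ∀ m m' : ℕ, ∀ c ∈ 𝒞 m, ∀ c' ∈ 𝒞 m', woplus c c' ∈ 𝒞 (m + m')

/-- `𝒞` is consistent for weighted resource graph games: every weighted resource
graph game whose cost function belongs to `𝒞` has a pure Nash equilibrium. -/
def WConsistent (𝒞 : WCostFamily) : Prop :=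
  ∀ m : ℕ, ∀ c ∈ 𝒞 m, ∀ n : ℕ, ∀ w : Fin n → NNReal, (∀ i, 0 < w i) →
    ∀ Y : Fin n → Finset (Fin m → ℕ), IsStrategySets Y →
      ∃ y, IsWPNE c w Y y

section TwoPlayerGames

/-- The load vector of two players with weights `v`, `w` on top of a background load `u`. -/
def pairLoad {m : ℕ} (u : Fin m → NNReal) (v w : NNReal) (a b : Fin m → ℕ) : Fin m → NNReal :=
  fun r => u r + v * (a r : NNReal) + w * (b r : NNReal)

/-- The cost of a player of weight `v` using the resources `a` under the load `x`. -/
noncomputable def strategyCost {m : ℕ} (c : (Fin m → NNReal) → Fin m → ℝ) (v : NNReal)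
    (a : Fin m → ℕ) (x : Fin m → NNReal) : ℝ :=
  ∑ r, ((v : ℝ) * (a r : ℝ)) * c x r

/-- The pairs `(p, q)` such that some game with a cost function in `𝒞` between two players of
weights `v` and `w` has a cycle of unilateral deviations whose cost changes alternate between
`p` and `q`. -/
def CycleChange (𝒞 : WCostFamily) (v w : NNReal) (p q : ℝ) : Prop :=
  ∃ m : ℕ, ∃ c ∈ 𝒞 m, ∃ (u : Fin m → NNReal) (a₀ a₁ b₀ b₁ : Fin m → ℕ),
    (∀ r, a₀ r ≤ 1 ∧ a₁ r ≤ 1 ∧ b₀ r ≤ 1 ∧ b₁ r ≤ 1) ∧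
    strategyCost c v a₁ (pairLoad u v w a₁ b₀) - strategyCost c v a₀ (pairLoad u v w a₀ b₀) = p ∧
    strategyCost c w b₁ (pairLoad u v w a₁ b₁) - strategyCost c w b₀ (pairLoad u v w a₁ b₀) = q ∧
    strategyCost c v a₀ (pairLoad u v w a₀ b₁) - strategyCost c v a₁ (pairLoad u v w a₁ b₁) = p ∧
    strategyCost c w b₀ (pairLoad u v w a₀ b₀) - strategyCost c w b₁ (pairLoad u v w a₀ b₁) = q

/-- Strategies of the single-resource players generating the background load `u`. -/
noncomputable def backgroundStrategy {m : ℕ} (u : Fin m → NNReal) (r s : Fin m) : ℕ :=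
  if s = r ∧ u r ≠ 0 then 1 else 0

/-- Weights of the single-resource players generating the background load `u`. -/
noncomputable def backgroundWeight {m : ℕ} (u : Fin m → NNReal) (r : Fin m) : NNReal :=
  if u r = 0 then 1 else u r

lemma wloadVec_background {m : ℕ} (u : Fin m → NNReal) (v w : NNReal) (a b : Fin m → ℕ) :
    wloadVec (Matrix.vecCons v (Matrix.vecCons w (backgroundWeight u)))
      (Matrix.vecCons a (Matrix.vecCons b (backgroundStrategy u))) = pairLoad u v w a b := by
  funext s
  have hbg : ∑ r, backgroundWeight u r * (backgroundStrategy u r s : NNReal) = u s := by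
    rw [Finset.sum_eq_single s]
    · by_cases h : u s = 0 <;> simp [backgroundWeight, backgroundStrategy, h]
    · intro r _ hr
      simp [backgroundStrategy, hr.symm]
    · simp
  simp only [wloadVec, pairLoad, Fin.sum_univ_succ, Matrix.cons_val_zero, Matrix.cons_val_succ,
    hbg]
  ring

lemma WConsistent.exists_equilibrium {𝒞 : WCostFamily} (h : WConsistent 𝒞) {m : ℕ}
    {c : (Fin m → NNReal) → Fin m → ℝ} (hc : c ∈ 𝒞 m) {v w : NNReal} (hv : 0 < v) (hw : 0 < w)
    (u : Fin m → NNReal) (Y₁ Y₂ : Finset (Fin m → ℕ)) (h₁ : Y₁.Nonempty) (h₂ : Y₂.Nonempty)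
    (k₁ : ∀ a ∈ Y₁, ∀ r, a r ≤ 1) (k₂ : ∀ b ∈ Y₂, ∀ r, b r ≤ 1) :
    ∃ a ∈ Y₁, ∃ b ∈ Y₂,
      (∀ a' ∈ Y₁, strategyCost c v a (pairLoad u v w a b) ≤
        strategyCost c v a' (pairLoad u v w a' b)) ∧
      ∀ b' ∈ Y₂, strategyCost c w b (pairLoad u v w a b) ≤
        strategyCost c w b' (pairLoad u v w a b') := by
  obtain ⟨y, hy, hmin⟩ := h m c hc (m + 2)
    (Matrix.vecCons v (Matrix.vecCons w (backgroundWeight u)))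
    (by
      refine Fin.cases hv (Fin.cases hw fun r => ?_)
      simp only [Matrix.cons_val_succ, backgroundWeight]
      split_ifs with h0
      exacts [one_pos, pos_iff_ne_zero.2 h0])
    (Matrix.vecCons Y₁ (Matrix.vecCons Y₂ fun r => {backgroundStrategy u r}))
    ⟨Fin.cases h₁ (Fin.cases h₂ fun r => by simp),
      Fin.cases k₁ (Fin.cases k₂ fun r x hx s => by
        simp only [Matrix.cons_val_succ, Finset.mem_singleton] at hx
        subst hx
        unfold backgroundStrategy
        split_ifs <;> simp)⟩
  have hy0 : y 0 ∈ Y₁ := hy 0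
  have hy1 : y 1 ∈ Y₂ := hy 1
  have hyeq : y = Matrix.vecCons (y 0) (Matrix.vecCons (y 1) (backgroundStrategy u)) := by
    funext i
    refine Fin.cases rfl (Fin.cases rfl fun r => ?_) i
    simpa using hy r.succ.succ
  generalize y 0 = a at *
  generalize y 1 = b at *
  subst hyeq
  have hup0 : ∀ a', Function.update (Matrix.vecCons a (Matrix.vecCons b (backgroundStrategy u)))
      0 a' = Matrix.vecCons a' (Matrix.vecCons b (backgroundStrategy u)) := by
    intro a'
    funext i
    refine Fin.cases ?_ (fun i => ?_) i <;> simp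
  have hup1 : ∀ b', Function.update (Matrix.vecCons a (Matrix.vecCons b (backgroundStrategy u)))
      1 b' = Matrix.vecCons a (Matrix.vecCons b' (backgroundStrategy u)) := by
    intro b'
    funext i
    refine Fin.cases ?_ (Fin.cases ?_ fun i => ?_) i
    · simp
    · rw [Fin.succ_zero_eq_one, Function.update_self]
      rfl
    · rw [Function.update_of_ne (fun h => by simpa using congrArg Fin.val h)]
      rfl
  refine ⟨a, hy0, b, hy1, fun a' ha' => ?_, fun b' hb' => ?_⟩
  · have := hmin 0 a' ha'
    rw [hup0] at this
    simpa only [wPlayerCost, strategyCost, wloadVec_background, Matrix.cons_val_zero] using this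
  · have := hmin 1 b' hb'
    rw [hup1] at this
    simpa only [wPlayerCost, strategyCost, wloadVec_background, Matrix.cons_val_one,
      Matrix.cons_val_zero] using this

lemma WConsistent.not_cycleChange_neg {𝒞 : WCostFamily} (h : WConsistent 𝒞) {v w : NNReal}
    (hv : 0 < v) (hw : 0 < w) {p q : ℝ} (hpq : CycleChange 𝒞 v w p q) (hp : p < 0) :
    0 ≤ q := by
  by_contra! hq
  obtain ⟨m, c, hc, u, a₀, a₁, b₀, b₁, hle, e1, e2, e3, e4⟩ := hpq
  obtain ⟨a, ha, b, hb, hA, hB⟩ := h.exists_equilibrium hc hv hw u {a₀, a₁} {b₀, b₁}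
    (by simp) (by simp)
    (by simpa using ⟨fun r => (hle r).1, fun r => (hle r).2.1⟩)
    (by simpa using ⟨fun r => (hle r).2.2.1, fun r => (hle r).2.2.2⟩)
  simp only [Finset.mem_insert, Finset.mem_singleton, forall_eq_or_imp, forall_eq]
    at ha hb hA hB
  rcases ha with rfl | rfl <;> rcases hb with rfl | rfl <;>
    linarith [hA.1, hA.2, hB.1, hB.2]

lemma strategyCost_woplus {m m' : ℕ} (c : (Fin m → NNReal) → Fin m → ℝ)
    (c' : (Fin m' → NNReal) → Fin m' → ℝ) (u : Fin m → NNReal) (u' : Fin m' → NNReal)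
    (v w z : NNReal) (a b d : Fin m → ℕ) (a' b' d' : Fin m' → ℕ) :
    strategyCost (woplus c c') z (Fin.append d d')
      (pairLoad (Fin.append u u') v w (Fin.append a a') (Fin.append b b')) =
    strategyCost c z d (pairLoad u v w a b) + strategyCost c' z d' (pairLoad u' v w a' b') := by
  simp [strategyCost, woplus, pairLoad, Fin.sum_univ_add]
  rfl

lemma append_le_one {m m' : ℕ} {a : Fin m → ℕ} {a' : Fin m' → ℕ} (h : ∀ r, a r ≤ 1)
    (h' : ∀ r, a' r ≤ 1) (r : Fin (m + m')) : Fin.append a a' r ≤ 1 := by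
  refine Fin.addCases (fun i => ?_) (fun i => ?_) r
  · simpa using h i
  · simpa using h' i

lemma CycleChange.add {𝒞 : WCostFamily} (hcomp : WClosedUnderComposition 𝒞) {v w : NNReal}
    {p q p' q' : ℝ} (h : CycleChange 𝒞 v w p q) (h' : CycleChange 𝒞 v w p' q') :
    CycleChange 𝒞 v w (p + p') (q + q') := by
  obtain ⟨m, c, hc, u, a₀, a₁, b₀, b₁, hle, e1, e2, e3, e4⟩ := h
  obtain ⟨m', c', hc', u', a₀', a₁', b₀', b₁', hle', e1', e2', e3', e4'⟩ := h'
  refine ⟨m + m', woplus c c', hcomp m m' c hc c' hc', Fin.append u u', Fin.append a₀ a₀',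
    Fin.append a₁ a₁', Fin.append b₀ b₀', Fin.append b₁ b₁',
    fun r => ⟨append_le_one (fun r => (hle r).1) (fun r => (hle' r).1) r,
      append_le_one (fun r => (hle r).2.1) (fun r => (hle' r).2.1) r,
      append_le_one (fun r => (hle r).2.2.1) (fun r => (hle' r).2.2.1) r,
      append_le_one (fun r => (hle r).2.2.2) (fun r => (hle' r).2.2.2) r⟩, ?_, ?_, ?_, ?_⟩ <;>
    simp only [strategyCost_woplus] <;> linarith

lemma CycleChange.neg {𝒞 : WCostFamily} {v w : NNReal} {p q : ℝ} (h : CycleChange 𝒞 v w p q) :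
    CycleChange 𝒞 v w (-p) (-q) := by
  obtain ⟨m, c, hc, u, a₀, a₁, b₀, b₁, hle, e1, e2, e3, e4⟩ := h
  refine ⟨m, c, hc, u, a₁, a₀, b₀, b₁,
    fun r => ⟨(hle r).2.1, (hle r).1, (hle r).2.2⟩, ?_, ?_, ?_, ?_⟩ <;> linarith

/-- The mixed difference of the cost of the player using `S` when the player using `T` enters,
per unit of weight. -/
noncomputable def mixedDifference {m : ℕ} (c : (Fin m → NNReal) → Fin m → ℝ) (v w : NNReal)
    (u : Fin m → NNReal) (S T : Finset (Fin m)) : ℝ :=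
  ∑ r ∈ S, (c (u + v • nindicVec S + w • nindicVec T) r - c (u + v • nindicVec S) r)

lemma cycleChange_mixedDifference {𝒞 : WCostFamily} (hcomp : WClosedUnderComposition 𝒞)
    {m : ℕ} {c : (Fin m → NNReal) → Fin m → ℝ} (hc : c ∈ 𝒞 m) (v w : NNReal)
    (u : Fin m → NNReal) (S T : Finset (Fin m)) :
    CycleChange 𝒞 v w (-(v * mixedDifference c v w u S T))
      (w * mixedDifference c w v u T S) := by
  let ind : Finset (Fin m) → Fin m → ℕ := fun S r => if r ∈ S then 1 else 0
  have hind : ∀ S r, ind S r ≤ 1 := fun S r => by simp only [ind]; split_ifs <;> simp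
  have hcost : ∀ z S x, strategyCost c z (ind S) x = z * ∑ r ∈ S, c x r := by
    intro z S x
    simp [strategyCost, ind, Finset.mul_sum]
  have hcost0 : ∀ z x, strategyCost c z 0 x = 0 := by
    intro z x
    simp [strategyCost]
  have hload : pairLoad u v w (ind S) (ind T) = u + v • nindicVec S + w • nindicVec T := by
    funext r
    simp [pairLoad, ind, nindicVec]
  have hload1 : pairLoad u v w (ind S) 0 = u + v • nindicVec S := by
    funext r
    simp [pairLoad, ind, nindicVec]
  have hload2 : pairLoad u v w 0 (ind T) = u + w • nindicVec T := by
    funext r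
    simp [pairLoad, ind, nindicVec]
  have h0 : ∀ r, (0 : Fin m → ℕ) r ≤ 1 := by simp
  refine ⟨m + m, woplus c c, hcomp m m c hc c hc, Fin.append u u, Fin.append 0 (ind S),
    Fin.append (ind S) 0, Fin.append 0 (ind T), Fin.append (ind T) 0,
    fun r => ⟨append_le_one h0 (hind S) r, append_le_one (hind S) h0 r,
      append_le_one h0 (hind T) r, append_le_one (hind T) h0 r⟩, ?_, ?_, ?_, ?_⟩ <;>
    simp only [strategyCost_woplus, hcost, hcost0, hload, hload1, hload2, mixedDifference,
      Finset.sum_sub_distrib, add_right_comm u (w • nindicVec T) (v • nindicVec S)] <;> ring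

lemma WConsistent.mixedDifference_mul_eq {𝒞 : WCostFamily} (h : WConsistent 𝒞)
    (hcomp : WClosedUnderComposition 𝒞) {v w : NNReal} (hv : 0 < v) (hw : 0 < w) {m m' : ℕ}
    {c : (Fin m → NNReal) → Fin m → ℝ} (hc : c ∈ 𝒞 m)
    {c' : (Fin m' → NNReal) → Fin m' → ℝ} (hc' : c' ∈ 𝒞 m')
    (u : Fin m → NNReal) (S T : Finset (Fin m)) (u' : Fin m' → NNReal)
    (S' T' : Finset (Fin m')) :
    mixedDifference c v w u S T * mixedDifference c' w v u' T' S' =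
      mixedDifference c w v u T S * mixedDifference c' v w u' S' T' := by
  have hz : CycleChange 𝒞 v w 0 0 := by
    simpa using (cycleChange_mixedDifference hcomp hc v w u S T).add hcomp
      (cycleChange_mixedDifference hcomp hc v w u S T).neg
  let G : AddSubgroup (ℝ × ℝ) :=
    { carrier := {x | CycleChange 𝒞 v w x.1 x.2}
      zero_mem' := hz
      add_mem' := fun hx hy => CycleChange.add hcomp hx hy
      neg_mem' := fun hx => CycleChange.neg hx }
  have hv' : (0 : ℝ) < v := by exact_mod_cast hv
  have hw' : (0 : ℝ) < w := by exact_mod_cast hw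
  have hx : ((-(v * mixedDifference c v w u S T), w * mixedDifference c w v u T S) : ℝ × ℝ) ∈ G :=
    cycleChange_mixedDifference hcomp hc v w u S T
  have hx' : ((-(v * mixedDifference c' v w u' S' T'),
      w * mixedDifference c' w v u' T' S') : ℝ × ℝ) ∈ G :=
    cycleChange_mixedDifference hcomp hc' v w u' S' T'
  generalize mixedDifference c v w u S T = f₁ at *
  generalize mixedDifference c w v u T S = f₂ at *
  generalize mixedDifference c' v w u' S' T' = g₁ at *
  generalize mixedDifference c' w v u' T' S' = g₂ at *
  obtain ⟨p, hp⟩ : ∃ p, p = -(v * f₁) := ⟨_, rfl⟩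
  obtain ⟨q, hq⟩ : ∃ q, q = w * f₂ := ⟨_, rfl⟩
  obtain ⟨p', hp'⟩ : ∃ p', p' = -(v * g₁) := ⟨_, rfl⟩
  obtain ⟨q', hq'⟩ : ∃ q', q' = w * g₂ := ⟨_, rfl⟩
  rw [← hp, ← hq] at hx
  rw [← hp', ← hq'] at hx'
  suffices hdet : p * q' - q * p' = 0 by
    subst hp hq hp' hq'
    have : v * w * (f₁ * g₂ - f₂ * g₁) = 0 := by linarith
    rcases mul_eq_zero.1 this with h0 | h0
    · exact absurd h0 (by positivity)
    · linarith
  by_contra hdet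
  set D := p * q' - q * p' with hD
  set N := |p| + |p'| + |q| + |q'| + 1 with hN
  set i := ⌊N * ((p' - q') / D)⌋ with hi
  set j := ⌊N * ((q - p) / D)⌋ with hj
  have hmem := G.add_mem (G.zsmul_mem hx i) (G.zsmul_mem hx' j)
  have hfract : ∀ y z : ℝ, Int.fract y * z ≤ |z| ∧ -|z| ≤ Int.fract y * z := by
    intro y z
    rw [and_comm, ← abs_le, abs_mul, abs_of_nonneg (Int.fract_nonneg y)]
    exact mul_le_of_le_one_left (abs_nonneg z) (Int.fract_lt_one y).le
  have hneg : ∀ a b : ℝ, N * ((p' - q') / D) * a + N * ((q - p) / D) * b = -N →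
      |a| + |b| < N → (i : ℝ) * a + j * b < 0 := by
    intro a b hab hlt
    have h1 := (hfract (N * ((p' - q') / D)) a).2
    have h2 := (hfract (N * ((q - p) / D)) b).2
    have h3 := Int.self_sub_floor (N * ((p' - q') / D))
    have h4 := Int.self_sub_floor (N * ((q - p) / D))
    rw [← h3, sub_mul, ← hi] at h1
    rw [← h4, sub_mul, ← hj] at h2
    linarith
  have hlt1 : (i : ℝ) * p + j * p' < 0 := by
    refine hneg p p' ?_ ?_
    · field_simp
      rw [hD]; ring
    · rw [hN]; linarith [abs_nonneg q, abs_nonneg q']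
  have hlt2 : (i : ℝ) * q + j * q' < 0 := by
    refine hneg q q' ?_ ?_
    · field_simp
      rw [hD]; ring
    · rw [hN]; linarith [abs_nonneg p, abs_nonneg p']
  have hcyc : CycleChange 𝒞 v w (i * p + j * p') (i * q + j * q') := by
    simpa [G] using hmem
  exact absurd (h.not_cycleChange_neg hv hw hcyc hlt1) (not_le.2 hlt2)

lemma WConsistent.mixedDifference_comm {𝒞 : WCostFamily} (h : WConsistent 𝒞)
    (hcomp : WClosedUnderComposition 𝒞) {w : NNReal} (hw : 0 < w) {m : ℕ}
    {c : (Fin m → NNReal) → Fin m → ℝ} (hc : c ∈ 𝒞 m) (u : Fin m → NNReal)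
    (S T : Finset (Fin m)) :
    mixedDifference c w w u S T = mixedDifference c w w u T S := by
  have hw' : (0 : ℝ) < w := by exact_mod_cast hw
  have hsq := h.mixedDifference_mul_eq hcomp hw hw hc hc u S T u T S
  have h1 := cycleChange_mixedDifference hcomp hc w w u S T
  have h2 := h1.neg
  rw [neg_neg] at h2
  rcases mul_self_eq_mul_self_iff.1 hsq with heq | heq
  · exact heq
  have hx : mixedDifference c w w u S T = 0 := by
    rcases lt_trichotomy (mixedDifference c w w u S T) 0 with h0 | h0 | h0
    · have := h.not_cycleChange_neg hw hw h2 (mul_neg_of_pos_of_neg hw' h0)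
      nlinarith
    · exact h0
    · have := h.not_cycleChange_neg hw hw h1 (neg_neg_of_pos (mul_pos hw' h0))
      nlinarith
  linarith

end TwoPlayerGames

section OneDimensional

open intervalIntegral

/-- The antiderivative of `t ↦ exp (φ t)` vanishing at `0`. -/
noncomputable def expPrimitive (φ x : ℝ) : ℝ := ∫ t in (0 : ℝ)..x, Real.exp (φ * t)

lemma hasDerivAt_expPrimitive (φ x : ℝ) :
    HasDerivAt (expPrimitive φ) (Real.exp (φ * x)) x := by
  have hc : Continuous fun t : ℝ => Real.exp (φ * t) := by fun_prop
  exact integral_hasDerivAt_right (hc.intervalIntegrable _ _)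
    (hc.stronglyMeasurableAtFilter _ _) hc.continuousAt

lemma expPrimitive_zero_right (φ : ℝ) : expPrimitive φ 0 = 0 := by
  simp [expPrimitive]

lemma expPrimitive_zero_left (x : ℝ) : expPrimitive 0 x = x := by
  simp [expPrimitive]

lemma expPrimitive_of_ne_zero {φ : ℝ} (hφ : φ ≠ 0) (x : ℝ) :
    expPrimitive φ x = (Real.exp (φ * x) - 1) / φ := by
  unfold expPrimitive
  rw [integral_comp_mul_left (fun t => Real.exp t) hφ]
  simp [div_eq_inv_mul]

lemma expPrimitive_one_ne_zero (φ : ℝ) : expPrimitive φ 1 ≠ 0 := by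
  have hc : Continuous fun t : ℝ => Real.exp (φ * t) := by fun_prop
  exact (intervalIntegral_pos_of_pos (hc.intervalIntegrable 0 1)
    (fun t => Real.exp_pos _) one_pos).ne'

/-- The exchange identity that consistency imposes on two one-dimensional cost sections. -/
def ExchangeIdentity (f g : ℝ → ℝ) : Prop :=
  ∀ s t v w : ℝ, 0 ≤ s → 0 ≤ t → 0 < v → 0 < w →
    (f (s + v + w) - f (s + v)) * (g (t + v + w) - g (t + w)) =
      (f (s + v + w) - f (s + w)) * (g (t + v + w) - g (t + v))

lemma ExchangeIdentity.symm {f g : ℝ → ℝ} (h : ExchangeIdentity f g) :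
    ExchangeIdentity g f := by
  intro s t v w hs ht hv hw
  linarith [h t s v w ht hs hv hw]

/-- The moving integral of `f` over a window of length `ε`. -/
noncomputable def windowIntegral (ε : ℝ) (f : ℝ → ℝ) (x : ℝ) : ℝ :=
  ∫ a in (0 : ℝ)..ε, f (x + a)

lemma hasDerivAt_windowIntegral {f : ℝ → ℝ} (hf : Continuous f) (ε x : ℝ) :
    HasDerivAt (windowIntegral ε f) (f (x + ε) - f x) x := by
  have hP : ∀ y, HasDerivAt (fun z => ∫ t in (0 : ℝ)..z, f t) (f y) y := fun y =>
    integral_hasDerivAt_right (hf.intervalIntegrable _ _)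
      (hf.stronglyMeasurableAtFilter _ _) hf.continuousAt
  have heq : windowIntegral ε f =
      fun y => (∫ t in (0 : ℝ)..(y + ε), f t) - ∫ t in (0 : ℝ)..y, f t := by
    funext y
    unfold windowIntegral
    rw [integral_comp_add_left, add_zero, integral_interval_sub_left] <;>
      exact hf.intervalIntegrable _ _
  rw [heq]
  exact ((hP (x + ε)).comp_add_const x ε).sub (hP x)

lemma continuous_windowIntegral {f : ℝ → ℝ} (hf : Continuous f) (ε : ℝ) :
    Continuous (windowIntegral ε f) :=
  continuous_iff_continuousAt.2 fun x => (hasDerivAt_windowIntegral hf ε x).continuousAt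

lemma contDiff_windowIntegral {f : ℝ → ℝ} {n : ℕ} (hf : ContDiff ℝ n f) (ε : ℝ) :
    ContDiff ℝ (n + 1 : ℕ) (windowIntegral ε f) := by
  have hd := hasDerivAt_windowIntegral hf.continuous ε
  push_cast
  rw [contDiff_succ_iff_deriv]
  refine ⟨fun x => (hd x).differentiableAt, by simp, ?_⟩
  rw [show deriv (windowIntegral ε f) = fun x => f (x + ε) - f x from
    funext fun x => (hd x).deriv]
  exact (hf.comp (contDiff_id.add contDiff_const)).sub hf

lemma ExchangeIdentity.windowIntegral_left {f g : ℝ → ℝ} (h : ExchangeIdentity f g)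
    (hf : Continuous f) {ε : ℝ} (hε : 0 < ε) :
    ExchangeIdentity (windowIntegral ε f) g := by
  intro s t v w hs ht hv hw
  have hi : ∀ y : ℝ, IntervalIntegrable (fun a => f (y + a)) MeasureTheory.volume 0 ε :=
    fun y => (hf.comp (continuous_const.add continuous_id)).intervalIntegrable _ _
  unfold windowIntegral
  rw [← integral_sub (hi _) (hi _), ← integral_sub (hi _) (hi _),
    ← integral_mul_const, ← integral_mul_const]
  refine integral_congr fun a ha => ?_
  rw [Set.uIcc_of_le hε.le] at ha
  have := h (s + a) t v w (by linarith [ha.1]) ht hv hw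
  convert this using 4 <;> ring_nf

lemma eq_zero_of_hasDerivAt_of_eq_zero_right {F : ℝ → ℝ} {d a : ℝ}
    (hd : HasDerivAt F d a) (hF : ∀ x, a < x → F x = 0) : d = 0 := by
  have hFa : F a = 0 := by
    have h1 : Filter.Tendsto F (nhdsWithin a (Set.Ioi a)) (nhds (F a)) :=
      hd.continuousAt.tendsto.mono_left nhdsWithin_le_nhds
    refine tendsto_nhds_unique h1 (tendsto_const_nhds.congr' ?_)
    filter_upwards [self_mem_nhdsWithin] with x hx using (hF x hx).symm
  have h0 : HasDerivWithinAt F 0 (Set.Ici a) a := by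
    refine (hasDerivWithinAt_const a (Set.Ici a) (0 : ℝ)).congr (fun x hx => ?_) hFa
    rcases eq_or_lt_of_le (show a ≤ x from hx) with rfl | h
    exacts [hFa, hF x h]
  exact (uniqueDiffOn_Ici a a Set.self_mem_Ici).eq_deriv _ hd.hasDerivWithinAt h0

lemma eq_zero_of_windowIntegral_eq_zero {k : ℝ → ℝ} (hk : Continuous k) {t : ℝ}
    (h : ∀ ε > 0, windowIntegral ε k t = 0) : k t = 0 := by
  have hc : Continuous fun a => k (t + a) := by fun_prop
  have hd : HasDerivAt (fun ε => windowIntegral ε k t) (k (t + 0)) 0 :=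
    integral_hasDerivAt_right (hc.intervalIntegrable _ _)
      (hc.stronglyMeasurableAtFilter _ _) hc.continuousAt
  simpa using eq_zero_of_hasDerivAt_of_eq_zero_right hd h

/-- Three-fold moving integral. -/
noncomputable def tripleWindowIntegral (ε₁ ε₂ ε₃ : ℝ) (f : ℝ → ℝ) : ℝ → ℝ :=
  windowIntegral ε₁ (windowIntegral ε₂ (windowIntegral ε₃ f))

lemma contDiff_tripleWindowIntegral {f : ℝ → ℝ} (hf : Continuous f) (ε₁ ε₂ ε₃ : ℝ) :
    ContDiff ℝ 3 (tripleWindowIntegral ε₁ ε₂ ε₃ f) := by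
  have h0 : ContDiff ℝ (0 : ℕ) f := by
    rw [Nat.cast_zero]
    exact contDiff_zero.2 hf
  have := contDiff_windowIntegral (contDiff_windowIntegral (contDiff_windowIntegral h0 ε₃) ε₂) ε₁
  exact this

lemma eq_zero_of_tripleWindowIntegral_eq_zero {k : ℝ → ℝ} (hk : Continuous k) {t : ℝ}
    (h : ∀ ε₁ > 0, ∀ ε₂ > 0, ∀ ε₃ > 0, tripleWindowIntegral ε₁ ε₂ ε₃ k t = 0) : k t = 0 := by
  refine eq_zero_of_windowIntegral_eq_zero hk fun ε₃ h₃ => ?_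
  have c₃ := continuous_windowIntegral hk ε₃
  refine eq_zero_of_windowIntegral_eq_zero c₃ fun ε₂ h₂ => ?_
  exact eq_zero_of_windowIntegral_eq_zero (continuous_windowIntegral c₃ ε₂)
    fun ε₁ h₁ => h ε₁ h₁ ε₂ h₂ ε₃ h₃

lemma ExchangeIdentity.tripleWindowIntegral_left {f g : ℝ → ℝ} (h : ExchangeIdentity f g)
    (hf : Continuous f) {ε₁ ε₂ ε₃ : ℝ} (h₁ : 0 < ε₁) (h₂ : 0 < ε₂) (h₃ : 0 < ε₃) :
    ExchangeIdentity (tripleWindowIntegral ε₁ ε₂ ε₃ f) g := by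
  have c₃ := continuous_windowIntegral hf ε₃
  exact ((h.windowIntegral_left hf h₃).windowIntegral_left c₃ h₂).windowIntegral_left
    (continuous_windowIntegral c₃ ε₂) h₁

/-- A linear combination of two translation differences of `f`. -/
def differenceCombination (p A q B : ℝ) (f : ℝ → ℝ) (t : ℝ) : ℝ :=
  (f (p + t) - f t) * A - (f (q + t) - f t) * B

lemma continuous_differenceCombination {f : ℝ → ℝ} (hf : Continuous f) (p A q B : ℝ) :
    Continuous (differenceCombination p A q B f) := by
  unfold differenceCombination
  fun_prop

lemma windowIntegral_differenceCombination {f : ℝ → ℝ} (hf : Continuous f) (ε p A q B : ℝ) :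
    windowIntegral ε (differenceCombination p A q B f) =
      differenceCombination p A q B (windowIntegral ε f) := by
  funext x
  have hi : ∀ y : ℝ, IntervalIntegrable (fun a => f (y + a)) MeasureTheory.volume 0 ε :=
    fun y => (hf.comp (continuous_const.add continuous_id)).intervalIntegrable _ _
  simp only [windowIntegral, differenceCombination, ← add_assoc]
  rw [integral_sub (((hi _).sub (hi _)).mul_const _) (((hi _).sub (hi _)).mul_const _),
    integral_mul_const, integral_mul_const, integral_sub (hi _) (hi _),
    integral_sub (hi _) (hi _)]

lemma tripleWindowIntegral_differenceCombination {f : ℝ → ℝ} (hf : Continuous f)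
    (ε₁ ε₂ ε₃ p A q B : ℝ) :
    tripleWindowIntegral ε₁ ε₂ ε₃ (differenceCombination p A q B f) =
      differenceCombination p A q B (tripleWindowIntegral ε₁ ε₂ ε₃ f) := by
  have c₃ := continuous_windowIntegral hf ε₃
  unfold tripleWindowIntegral
  rw [windowIntegral_differenceCombination hf, windowIntegral_differenceCombination c₃,
    windowIntegral_differenceCombination (continuous_windowIntegral c₃ ε₂)]

lemma ExchangeIdentity.deriv_mul_deriv {f g : ℝ → ℝ} (h : ExchangeIdentity f g)
    (hf : ContDiff ℝ 3 f) (hg : ContDiff ℝ 3 g) {s t : ℝ} (hs : 0 ≤ s) (ht : 0 ≤ t) :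
    deriv (deriv f) s * deriv g t = deriv f s * deriv (deriv g) t := by
  have key : ∀ {f : ℝ → ℝ}, ContDiff ℝ 3 f → (∀ x, HasDerivAt f (deriv f x) x) ∧
      (∀ x, HasDerivAt (deriv f) (deriv (deriv f) x) x) ∧
      ∀ x, HasDerivAt (deriv (deriv f)) (deriv (deriv (deriv f)) x) x := by
    intro f hf
    have h2 : ContDiff ℝ 2 (deriv f) :=
      (contDiff_succ_iff_deriv (n := 2) (f := f)).1 (by norm_num; exact hf) |>.2.2
    have h1 : ContDiff ℝ 1 (deriv (deriv f)) :=
      (contDiff_succ_iff_deriv (n := 1) (f := deriv f)).1 (by norm_num; exact h2) |>.2.2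
    exact ⟨fun x => (hf.differentiable (by norm_num) x).hasDerivAt,
      fun x => (h2.differentiable (by norm_num) x).hasDerivAt,
      fun x => (h1.differentiable (by norm_num) x).hasDerivAt⟩
  obtain ⟨f1, f2, f3⟩ := key hf
  obtain ⟨g1, g2, g3⟩ := key hg
  have step1 : ∀ v > 0, deriv f (s + v) * (g (t + v) - g t) -
      (f (s + v) - f s) * deriv g (t + v) = 0 := by
    intro v hv
    have hd := ((((f1 (s + v + 0)).comp_const_add (s + v) 0).sub_const (f (s + v))).mul
      (((g1 (t + v + 0)).comp_const_add (t + v) 0).sub ((g1 (t + 0)).comp_const_add t 0))).sub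
      ((((f1 (s + v + 0)).comp_const_add (s + v) 0).sub ((f1 (s + 0)).comp_const_add s 0)).mul
      (((g1 (t + v + 0)).comp_const_add (t + v) 0).sub_const (g (t + v))))
    have := eq_zero_of_hasDerivAt_of_eq_zero_right hd fun w hw => by
      simpa using sub_eq_zero.2 (h s t v w hs ht hv hw)
    simpa using this
  have step2 : ∀ v > 0, deriv (deriv f) (s + v) * (g (t + v) - g t) -
      (f (s + v) - f s) * deriv (deriv g) (t + v) = 0 := by
    intro v hv
    have hd := (((f2 (s + v)).comp_const_add s v).mul
      (((g1 (t + v)).comp_const_add t v).sub_const (g t))).sub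
      ((((f1 (s + v)).comp_const_add s v).sub_const (f s)).mul
      ((g2 (t + v)).comp_const_add t v))
    have := eq_zero_of_hasDerivAt_of_eq_zero_right hd fun w hw => by
      simpa using step1 w (hv.trans hw)
    linarith
  have hd := (((f3 (s + 0)).comp_const_add s 0).mul
    (((g1 (t + 0)).comp_const_add t 0).sub_const (g t))).sub
    ((((f1 (s + 0)).comp_const_add s 0).sub_const (f s)).mul
    ((g3 (t + 0)).comp_const_add t 0))
  have := eq_zero_of_hasDerivAt_of_eq_zero_right hd fun w hw => by
    simpa using step2 w hw
  simp at this
  linarith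

lemma eq_of_hasDerivAt_zero {M : ℝ → ℝ} (hM : ∀ s, 0 ≤ s → HasDerivAt M 0 s) {x : ℝ}
    (hx : 0 ≤ x) : M x = M 0 :=
  constant_of_has_deriv_right_zero
    (fun s hs => (hM s hs.1).continuousAt.continuousWithinAt)
    (fun s hs => (hM s hs.1).hasDerivWithinAt) x ⟨hx, le_rfl⟩

lemma sub_eq_mul_expPrimitive {F : ℝ → ℝ} {φ : ℝ} (hF : ContDiff ℝ 3 F)
    (hode : ∀ s, 0 ≤ s → deriv (deriv F) s = φ * deriv F s) {x : ℝ} (hx : 0 ≤ x) :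
    F x - F 0 = deriv F 0 * expPrimitive φ x := by
  have h2 : ContDiff ℝ 2 (deriv F) :=
    (contDiff_succ_iff_deriv (n := 2) (f := F)).1 (by norm_num; exact hF) |>.2.2
  have d1 : ∀ y, HasDerivAt F (deriv F y) y :=
    fun y => (hF.differentiable (by norm_num) y).hasDerivAt
  have d2 : ∀ y, HasDerivAt (deriv F) (deriv (deriv F) y) y :=
    fun y => (h2.differentiable (by norm_num) y).hasDerivAt
  have he : ∀ c s : ℝ, HasDerivAt (fun s => Real.exp (c * s)) (Real.exp (c * s) * c) s := by
    intro c s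
    simpa using ((hasDerivAt_id s).const_mul c).exp
  have hfirst : ∀ s, 0 ≤ s → deriv F s = deriv F 0 * Real.exp (φ * s) := by
    intro s hs
    have := eq_of_hasDerivAt_zero (M := fun s => deriv F s * Real.exp (-φ * s)) (fun s hs => by
      refine ((d2 s).mul (he (-φ) s)).congr_deriv ?_
      rw [hode s hs]; ring) hs
    simp only [mul_zero, Real.exp_zero, mul_one] at this
    rw [← this, mul_assoc, ← Real.exp_add]
    simp
  have := eq_of_hasDerivAt_zero (M := fun s => F s - deriv F 0 * expPrimitive φ s)
    (fun s hs => by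
      refine ((d1 s).sub ((hasDerivAt_expPrimitive φ s).const_mul (deriv F 0))).congr_deriv ?_
      rw [hfirst s hs]; ring) hx
  simp only [expPrimitive_zero_right] at this
  linarith

/-- A pairwise exchange-related family of continuous functions consists of affine images of a
single exponential primitive. -/
theorem exists_common_exponent (ℱ : Set (ℝ → ℝ)) (hcont : ∀ f ∈ ℱ, Continuous f)
    (hpair : ∀ f ∈ ℱ, ∀ g ∈ ℱ, ExchangeIdentity f g) :
    ∃ φ : ℝ, ∀ f ∈ ℱ, ∀ x, 0 ≤ x →
      (f x - f 0) * expPrimitive φ 1 = (f 1 - f 0) * expPrimitive φ x := by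
  by_cases hconst : ∀ f ∈ ℱ, ∀ x, 0 ≤ x → f x = f 0
  · exact ⟨0, fun f hf x hx => by rw [hconst f hf x hx, hconst f hf 1 zero_le_one]; simp⟩
  push Not at hconst
  obtain ⟨g, hg, x₀, hx₀, hne⟩ := hconst
  have hgc := hcont g hg
  obtain ⟨ε₁, h₁, ε₂, h₂, ε₃, h₃, t, ht, hdt⟩ : ∃ ε₁ > 0, ∃ ε₂ > 0, ∃ ε₃ > 0, ∃ t, 0 ≤ t ∧
      deriv (tripleWindowIntegral ε₁ ε₂ ε₃ g) t ≠ 0 := by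
    by_contra! hall
    refine hne (sub_eq_zero.1 ?_)
    have := eq_zero_of_tripleWindowIntegral_eq_zero
      (continuous_differenceCombination hgc x₀ 1 0 0) (t := 0) fun ε₁ h₁ ε₂ h₂ ε₃ h₃ => by
        rw [tripleWindowIntegral_differenceCombination hgc]
        have hd : ∀ s, 0 ≤ s → HasDerivAt (tripleWindowIntegral ε₁ ε₂ ε₃ g) 0 s := by
          intro s hs
          rw [← hall ε₁ h₁ ε₂ h₂ ε₃ h₃ s hs]
          exact ((contDiff_tripleWindowIntegral hgc ε₁ ε₂ ε₃).differentiable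
            (by norm_num) s).hasDerivAt
        simp [differenceCombination, eq_of_hasDerivAt_zero hd hx₀]
    simpa [differenceCombination] using this
  set G := tripleWindowIntegral ε₁ ε₂ ε₃ g with hG
  refine ⟨deriv (deriv G) t / deriv G t, fun f hf x hx => ?_⟩
  set φ := deriv (deriv G) t / deriv G t with hφ
  have hfc := hcont f hf
  have hGf : ExchangeIdentity G f := (hpair g hg f hf).tripleWindowIntegral_left hgc h₁ h₂ h₃
  have := eq_zero_of_tripleWindowIntegral_eq_zero (continuous_differenceCombination hfc x
    (expPrimitive φ 1) 1 (expPrimitive φ x)) (t := 0) fun δ₁ k₁ δ₂ k₂ δ₃ k₃ => by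
      rw [tripleWindowIntegral_differenceCombination hfc]
      have hFG := hGf.symm.tripleWindowIntegral_left hfc k₁ k₂ k₃
      have hF := contDiff_tripleWindowIntegral hfc δ₁ δ₂ δ₃
      have hode : ∀ s, 0 ≤ s → deriv (deriv (tripleWindowIntegral δ₁ δ₂ δ₃ f)) s =
          φ * deriv (tripleWindowIntegral δ₁ δ₂ δ₃ f) s := by
        intro s hs
        have := hFG.deriv_mul_deriv hF (contDiff_tripleWindowIntegral hgc ε₁ ε₂ ε₃) hs ht
        rw [hφ]
        field_simp
        linarith
      simp only [differenceCombination, add_zero]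
      rw [sub_eq_mul_expPrimitive hF hode hx, sub_eq_mul_expPrimitive hF hode zero_le_one]
      ring
  simpa [differenceCombination, sub_eq_zero] using this

lemma eq_zero_of_expPrimitive_linear {φ : ℝ}
    (h : ∀ x, 0 ≤ x → x * expPrimitive φ 1 = expPrimitive φ x) : φ = 0 := by
  by_contra hφ
  have h2 := h 2 zero_le_two
  rw [expPrimitive_of_ne_zero hφ, expPrimitive_of_ne_zero hφ] at h2
  field_simp at h2
  rw [two_mul φ, Real.exp_add] at h2
  have h3 : (Real.exp φ - 1) ^ 2 = 0 := by linarith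
  have h4 : Real.exp φ = 1 := by nlinarith [pow_eq_zero_iff (two_ne_zero) |>.1 h3]
  exact hφ (Real.exp_eq_one_iff φ |>.1 h4)

end OneDimensional

section Separation

lemma smul_nindicVec_singleton {m : ℕ} (w : NNReal) (r : Fin m) :
    w • nindicVec {r} = Pi.single r w := by
  funext s
  by_cases h : s = r
  · subst h; simp [nindicVec]
  · simp [nindicVec, h]

lemma smul_nindicVec_pair {m : ℕ} (w : NNReal) {r s : Fin m} (hrs : r ≠ s) :
    w • nindicVec {r, s} = Pi.single r w + Pi.single s w := by
  rw [← smul_nindicVec_singleton, ← smul_nindicVec_singleton, ← smul_add]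
  congr 1
  funext q
  by_cases h : q = r
  · subst h; simp [nindicVec, hrs]
  · simp [nindicVec, h]

lemma nonpos_of_local_midpoint {k : ℝ → ℝ} (hk : Continuous k) {T δ : ℝ}
    (hδ : 0 < δ) (h0 : k 0 = 0) (hT0 : k T = 0)
    (hmid : ∀ t w, 0 ≤ t → 0 < w → w ≤ δ → k (t + w + w) + k t = 2 * k (t + w)) {t : ℝ}
    (ht : t ∈ Set.Icc 0 T) : k t ≤ 0 := by
  obtain ⟨x, hx, hmax⟩ := isCompact_Icc.exists_isMaxOn ⟨t, ht⟩ hk.continuousOn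
  have hne : (Set.Icc 0 T ∩ k ⁻¹' {k x}).Nonempty := ⟨x, hx, rfl⟩
  obtain ⟨y, ⟨hy, hyx⟩, hleast⟩ := (isCompact_Icc.inter_right
    (isClosed_singleton.preimage hk)).exists_isLeast hne
  have hyx : k y = k x := hyx
  have hmaxy : ∀ z ∈ Set.Icc 0 T, k z ≤ k y := fun z hz => hyx ▸ hmax hz
  refine (hmaxy t ht).trans ?_
  rcases eq_or_lt_of_le hy.1 with h | hy0
  · rw [← h, h0]
  rcases eq_or_lt_of_le hy.2 with h | hyT
  · rw [h, hT0]
  exfalso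
  obtain ⟨w, hw, hwlt⟩ := exists_between (lt_min hδ (lt_min hy0 (sub_pos.2 hyT)))
  have hw1 : w ≤ δ := hwlt.le.trans (min_le_left _ _)
  have hw2 : w ≤ y := hwlt.le.trans ((min_le_right _ _).trans (min_le_left _ _))
  have hw3 : w ≤ T - y := hwlt.le.trans ((min_le_right _ _).trans (min_le_right _ _))
  have hm := hmid (y - w) w (by linarith) hw hw1
  rw [sub_add_cancel] at hm
  have hr := hmaxy (y + w) ⟨by linarith, by linarith⟩
  have hl := hmaxy (y - w) ⟨by linarith, by linarith⟩
  have := hleast ⟨⟨by linarith, by linarith⟩, show k (y - w) = k x by linarith⟩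
  linarith

lemma eq_linear_of_local_midpoint {h : ℝ → ℝ} (hh : Continuous h) {δ : ℝ} (hδ : 0 < δ)
    (hmid : ∀ t w, 0 ≤ t → 0 < w → w ≤ δ → h (t + w + w) + h t = 2 * h (t + w)) {t : ℝ}
    (ht : 0 ≤ t) : h t = h 0 + t * (h 1 - h 0) := by
  have key : ∀ T, 0 ≤ T → ∀ s ∈ Set.Icc 0 T, (h s - h 0) * T = s * (h T - h 0) := by
    intro T hT s hs
    have h1 := nonpos_of_local_midpoint (k := fun s => (h s - h 0) * T - s * (h T - h 0))
      (by fun_prop) hδ (by simp) (by ring)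
      (fun t w h1 h2 h3 => by linear_combination T * hmid t w h1 h2 h3) hs
    have h2 := nonpos_of_local_midpoint (k := fun s => s * (h T - h 0) - (h s - h 0) * T)
      (by fun_prop) hδ (by simp) (by ring)
      (fun t w h1 h2 h3 => by linear_combination -T * hmid t w h1 h2 h3) hs
    linarith
  rcases le_total t 1 with h1 | h1
  · linarith [key 1 zero_le_one t ⟨ht, h1⟩]
  · linarith [key t ht 1 ⟨zero_le_one, h1⟩]

lemma eq_zero_of_pos_eq_zero {k : NNReal → ℝ} (hk : Continuous k) (h : ∀ t, 0 < t → k t = 0) :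
    k 0 = 0 := by
  have hd : Dense (Set.Ioi (0 : NNReal)) := by
    rw [dense_iff_closure_eq, closure_Ioi]
    ext x; simp
  have := hk.ext_on hd (continuous_const (y := (0 : ℝ))) fun t ht => h t ht
  exact congrFun this 0

lemma continuous_singleLoad {m : ℕ} (r : Fin m) :
    Continuous fun t : NNReal => (Pi.single r t : Fin m → NNReal) :=
  continuous_single (A := fun _ : Fin m => NNReal) r

lemma eq_of_forall_add_single {m : ℕ} {g : (Fin m → NNReal) → ℝ}
    (h : ∀ q t u, g (u + Pi.single q t) = g u) (u : Fin m → NNReal) : g u = g 0 := by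
  have key : ∀ S : Finset (Fin m), g (∑ q ∈ S, Pi.single q (u q)) = g 0 := by
    intro S
    induction S using Finset.induction_on with
    | empty => simp
    | insert q S hq ih => rw [Finset.sum_insert hq, add_comm, h, ih]
  simpa [Finset.univ_sum_single] using key univ

section SymmetricMixedDifference

variable {m : ℕ} {c : (Fin m → NNReal) → Fin m → ℝ}

lemma second_difference_eq_zero
    (hsym : ∀ w : NNReal, 0 < w → ∀ u S T,
      mixedDifference c w w u S T = mixedDifference c w w u T S)
    {r s : Fin m} (hrs : r ≠ s) {w : NNReal} (hw : 0 < w) {z : Fin m → NNReal} (hz : w ≤ z s) :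
    c (z + Pi.single r w + Pi.single r w) s + c z s = 2 * c (z + Pi.single r w) s := by
  obtain ⟨u, rfl⟩ : ∃ u : Fin m → NNReal, z = u + Pi.single s w := by
    refine ⟨Function.update z s (z s - w), ?_⟩
    funext q
    by_cases hq : q = s
    · subst hq
      rw [Pi.add_apply, Function.update_self, Pi.single_eq_same, tsub_add_cancel_of_le hz]
    · simp [hq]
  have h1 := hsym w hw u {r} {s}
  have h2 := hsym w hw u {r} {r, s}
  simp only [mixedDifference, Finset.sum_singleton, Finset.sum_pair hrs,
    smul_nindicVec_pair w hrs, smul_nindicVec_singleton] at h1 h2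
  have e1 : u + Pi.single r w + (Pi.single r w + Pi.single s w) =
      u + Pi.single s w + Pi.single r w + Pi.single r w := by abel
  have e3 : u + (Pi.single r w + Pi.single s w) = u + Pi.single s w + Pi.single r w := by abel
  have e4 : u + Pi.single r w + Pi.single s w = u + Pi.single s w + Pi.single r w := by abel
  simp only [e1, e3, e4] at h1 h2
  linarith

lemma cost_add_single (hc : Continuous c)
    (hsym : ∀ w : NNReal, 0 < w → ∀ u S T,
      mixedDifference c w w u S T = mixedDifference c w w u T S)
    {r s : Fin m} (hrs : r ≠ s) (z : Fin m → NNReal) (t : NNReal) :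
    c (z + Pi.single r t) s = c z s + t * (c (z + Pi.single r 1) s - c z s) := by
  have hpos : ∀ z : Fin m → NNReal, 0 < z s →
      c (z + Pi.single r t) s = c z s + t * (c (z + Pi.single r 1) s - c z s) := by
    intro z hz
    have := eq_linear_of_local_midpoint
      (h := fun t : ℝ => c (z + Pi.single r t.toNNReal) s)
      ((continuous_apply s).comp (hc.comp
        (((continuous_singleLoad r).comp continuous_real_toNNReal).const_add z)))
      (show (0 : ℝ) < z s from hz) (fun t w ht hw hwz => by
        have := second_difference_eq_zero hsym hrs (w := w.toNNReal) (by simpa using hw)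
          (z := z + Pi.single r t.toNNReal)
          (by simpa [hrs.symm] using Real.toNNReal_le_iff_le_coe.2 hwz)
        simp only [Real.toNNReal_add ht hw.le, Real.toNNReal_add (add_nonneg ht hw.le) hw.le,
          Pi.single_add, ← add_assoc]
        exact this) t.coe_nonneg
    simpa using this
  have := eq_zero_of_pos_eq_zero (k := fun ε => c (z + Pi.single s ε + Pi.single r t) s -
    (c (z + Pi.single s ε) s + t * (c (z + Pi.single s ε + Pi.single r 1) s -
      c (z + Pi.single s ε) s))) (by
        have hs := continuous_singleLoad s
        have hcs : ∀ f : NNReal → Fin m → NNReal, Continuous f → Continuous fun t => c (f t) s :=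
          fun f hf => (continuous_apply s).comp (hc.comp hf)
        have h0 := hcs _ (hs.const_add z)
        have h1 := hcs _ ((hs.const_add z).add_const (Pi.single r t))
        have h2 := hcs _ ((hs.const_add z).add_const (Pi.single r 1))
        exact h1.sub (h0.add ((h2.sub h0).const_mul (t : ℝ)))) (fun ε hε => by
        rw [hpos _ (by simp [hε]), sub_self])
  simpa [sub_eq_zero] using this

lemma cost_increment_comm (hc : Continuous c)
    (hsym : ∀ w : NNReal, 0 < w → ∀ u S T,
      mixedDifference c w w u S T = mixedDifference c w w u T S)
    {r s : Fin m} (hrs : r ≠ s) (u : Fin m → NNReal) :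
    c (u + Pi.single r 1) s - c u s = c (u + Pi.single s 1) r - c u r := by
  have hpos : ∀ w : NNReal, 0 < w →
      c (u + Pi.single s w + Pi.single r 1) s - c (u + Pi.single s w) s =
        c (u + Pi.single r w + Pi.single s 1) r - c (u + Pi.single r w) r := by
    intro w hw
    have h1 := hsym w hw u {r} {s}
    simp only [mixedDifference, Finset.sum_singleton, smul_nindicVec_singleton] at h1
    rw [cost_add_single hc hsym hrs.symm, cost_add_single hc hsym hrs] at h1
    have hw' : (w : ℝ) ≠ 0 := by exact_mod_cast hw.ne'
    exact (mul_left_cancel₀ hw' (by linarith)).symm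
  have := eq_zero_of_pos_eq_zero (k := fun w =>
      c (u + Pi.single s w + Pi.single r 1) s - c (u + Pi.single s w) s -
        (c (u + Pi.single r w + Pi.single s 1) r - c (u + Pi.single r w) r)) (by
        have hs := continuous_singleLoad s
        have hr := continuous_singleLoad r
        have hcq : ∀ q, ∀ f : NNReal → Fin m → NNReal, Continuous f →
            Continuous fun t => c (f t) q :=
          fun q f hf => (continuous_apply q).comp (hc.comp hf)
        exact ((hcq s _ ((hs.const_add u).add_const (Pi.single r 1))).sub
          (hcq s _ (hs.const_add u))).sub
          ((hcq r _ ((hr.const_add u).add_const (Pi.single s 1))).sub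
          (hcq r _ (hr.const_add u)))) (fun w hw => by rw [hpos w hw, sub_self])
  simpa [sub_eq_zero] using this

lemma cost_increment_eq (hc : Continuous c)
    (hsym : ∀ w : NNReal, 0 < w → ∀ u S T,
      mixedDifference c w w u S T = mixedDifference c w w u T S)
    {r s : Fin m} (hrs : r ≠ s) (u : Fin m → NNReal) :
    c (u + Pi.single s 1) r - c u r = c (Pi.single s 1) r - c 0 r := by
  have hself : ∀ {r s : Fin m}, r ≠ s → ∀ t u,
      c (u + Pi.single s t + Pi.single s 1) r - c (u + Pi.single s t) r =
        c (u + Pi.single s 1) r - c u r := by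
    intro r s hrs t u
    rw [add_assoc, ← Pi.single_add, cost_add_single hc hsym hrs.symm u (t + 1),
      cost_add_single hc hsym hrs.symm u t]
    push_cast
    ring
  have hown : ∀ {r s : Fin m}, r ≠ s → ∀ t u,
      c (u + Pi.single r t + Pi.single s 1) r - c (u + Pi.single r t) r =
        c (u + Pi.single s 1) r - c u r := by
    intro r s hrs t u
    rw [cost_increment_comm hc hsym hrs.symm, cost_increment_comm hc hsym hrs.symm,
      hself hrs.symm]
  have := eq_of_forall_add_single (g := fun u => c (u + Pi.single s 1) r - c u r)
    (fun q t u => ?_) u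
  · simpa using this
  by_cases hqs : q = s
  · subst hqs; exact hself hrs t u
  by_cases hqr : q = r
  · subst hqr; exact hown hrs t u
  rcases eq_or_lt_of_le (show 0 ≤ t from zero_le) with rfl | ht
  · simp
  have ht' : (t : ℝ) ≠ 0 := by exact_mod_cast ht.ne'
  have hsq : s ≠ q := Ne.symm hqs
  have hrq : r ≠ q := Ne.symm hqr
  have h := hsym t ht u {r} {s, q}
  simp only [mixedDifference, Finset.sum_singleton, Finset.sum_pair hsq,
    smul_nindicVec_pair t hsq, smul_nindicVec_singleton] at h
  have hL1 := cost_add_single hc hsym hrs.symm (u + Pi.single r t) t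
  have hL2 := cost_add_single hc hsym hrq.symm (u + Pi.single r t + Pi.single s t) t
  have hR1 := cost_add_single hc hsym hrs (u + Pi.single s t + Pi.single q t) t
  have hR2 := cost_add_single hc hsym hrq (u + Pi.single s t + Pi.single q t) t
  rw [hown hrs] at hL1
  rw [add_right_comm u, hown hrq] at hL2
  rw [cost_increment_comm hc hsym hrs, add_right_comm u, hself hrs] at hR1
  rw [cost_increment_comm hc hsym hrq, hself hrq] at hR2
  rw [add_right_comm u (Pi.single q t) (Pi.single s t)] at hR1
  rw [add_right_comm u (Pi.single s t) (Pi.single r t)] at hL2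
  simp only [← add_assoc] at h
  have e : u + Pi.single s t + Pi.single q t + Pi.single r t =
    u + Pi.single r t + Pi.single s t + Pi.single q t := by abel
  rw [e] at h hR1 hR2
  refine mul_left_cancel₀ ht' ?_
  linarith

/-- Off its own coordinate, a cost function with symmetric mixed differences is linear with
symmetric coefficients. -/
theorem cost_eq_section_add_linear (hc : Continuous c)
    (hsym : ∀ w : NNReal, 0 < w → ∀ u S T,
      mixedDifference c w w u S T = mixedDifference c w w u T S)
    (x : Fin m → NNReal) (r : Fin m) :
    c x r = c (Pi.single r (x r)) r +
      ∑ s ∈ univ.erase r, (c (Pi.single s 1) r - c 0 r) * (x s : ℝ) := by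
  have key : ∀ S : Finset (Fin m), r ∉ S →
      c (Pi.single r (x r) + ∑ s ∈ S, Pi.single s (x s)) r = c (Pi.single r (x r)) r +
        ∑ s ∈ S, (c (Pi.single s 1) r - c 0 r) * (x s : ℝ) := by
    intro S
    induction S using Finset.induction_on with
    | empty => simp
    | insert q S hq ih =>
      intro hr
      rw [Finset.mem_insert, not_or] at hr
      rw [Finset.sum_insert hq, Finset.sum_insert hq, add_left_comm,
        add_comm,
        cost_add_single hc hsym (Ne.symm hr.1), cost_increment_eq hc hsym hr.1, ih hr.2]
      ring
  have := key (univ.erase r) (Finset.notMem_erase r univ)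
  rwa [Finset.add_sum_erase univ (fun s => (Pi.single s (x s) : Fin m → NNReal)) (mem_univ r),
    Finset.univ_sum_single] at this

end SymmetricMixedDifference

end Separation

section Potential

/-- A weighted potential on the profiles of a finite game yields a pure Nash equilibrium. -/
theorem exists_isWPNE_of_potential {n m : ℕ} {c : (Fin m → NNReal) → Fin m → ℝ}
    {w : Fin n → NNReal} {Y : Fin n → Finset (Fin m → ℕ)} (hY : ∀ i, (Y i).Nonempty)
    (P : (Fin n → Fin m → ℕ) → ℝ) (κ : Fin n → ℝ) (hκ : ∀ i, 0 < κ i)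
    (hP : ∀ y, (∀ i, y i ∈ Y i) → ∀ i, ∀ y' ∈ Y i,
      P (Function.update y i y') - P y =
        κ i * (wPlayerCost c w (Function.update y i y') i - wPlayerCost c w y i)) :
    ∃ y, IsWPNE c w Y y := by
  obtain ⟨y, hy, hmin⟩ := Finset.exists_min_image (Fintype.piFinset Y) P
    (Fintype.piFinset_nonempty.2 hY)
  rw [Fintype.mem_piFinset] at hy
  refine ⟨y, hy, fun i y' hy' => ?_⟩
  have hmem : Function.update y i y' ∈ Fintype.piFinset Y := by
    rw [Fintype.mem_piFinset]
    intro j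
    rcases eq_or_ne j i with rfl | hj
    · simpa using hy'
    · simpa [Function.update_of_ne hj] using hy j
  have h1 := hP y hy i y' hy'
  have h2 := hmin _ hmem
  have h3 : 0 ≤ κ i * (wPlayerCost c w (Function.update y i y') i - wPlayerCost c w y i) := by
    linarith
  linarith [nonneg_of_mul_nonneg_right h3 (hκ i)]

/-- The load caused by all players other than `i`. -/
def otherLoad {n m : ℕ} (w : Fin n → NNReal) (y : Fin n → Fin m → ℕ) (i : Fin n) (r : Fin m) :
    NNReal := ∑ j ∈ univ.erase i, w j * (y j r : NNReal)

lemma otherLoad_update {n m : ℕ} (w : Fin n → NNReal) (y : Fin n → Fin m → ℕ) (i : Fin n)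
    (y' : Fin m → ℕ) : otherLoad w (Function.update y i y') i = otherLoad w y i := by
  funext r
  refine Finset.sum_congr rfl fun j hj => ?_
  rw [Function.update_of_ne (Finset.ne_of_mem_erase hj)]

lemma wloadVec_eq {n m : ℕ} (w : Fin n → NNReal) (y : Fin n → Fin m → ℕ) (i : Fin n)
    (r : Fin m) : wloadVec w y r = otherLoad w y i r + w i * (y i r : NNReal) :=
  (Finset.sum_erase_add univ _ (mem_univ i)).symm

lemma sum_update_sub_sum {n : ℕ} {α : Type*} (y : Fin n → α) (i : Fin n) (y' : α)
    (g : Fin n → α → ℝ) :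
    ∑ j, g j (Function.update y i y' j) - ∑ j, g j (y j) = g i y' - g i (y i) := by
  rw [← Finset.sum_sub_distrib, Finset.sum_eq_single i]
  · simp
  · intro j _ hj
    simp [Function.update_of_ne hj]
  · simp

open Matrix in
theorem exists_isWPNE_of_affine {n m : ℕ} {c : (Fin m → NNReal) → Fin m → ℝ}
    {w : Fin n → NNReal} {Y : Fin n → Finset (Fin m → ℕ)} (hY : ∀ i, (Y i).Nonempty)
    (A : Matrix (Fin m) (Fin m) ℝ) (hA : A.IsSymm) (b : Fin m → ℝ)
    (hc : ∀ x r, c x r = (∑ s, A r s * (x s : ℝ)) + b r) :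
    ∃ y, IsWPNE c w Y y := by
  let X : Fin n → (Fin m → ℕ) → Fin m → ℝ := fun i v r => (w i : ℝ) * (v r : ℝ)
  let L : (Fin n → Fin m → ℕ) → Fin m → ℝ := fun y r => (wloadVec w y r : ℝ)
  have hcost : ∀ y i, wPlayerCost c w y i = X i (y i) ⬝ᵥ (A *ᵥ L y) + X i (y i) ⬝ᵥ b := by
    intro y i
    rw [← dotProduct_add]
    simp only [wPlayerCost, hc, dotProduct, mulVec, X, L, Pi.add_apply]
  have hL : ∀ y i, L y = (fun r => (otherLoad w y i r : ℝ)) + X i (y i) := by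
    intro y i
    funext r
    simp [L, X, wloadVec_eq w y i]
  have hsymm : ∀ p q : Fin m → ℝ, p ⬝ᵥ (A *ᵥ q) = q ⬝ᵥ (A *ᵥ p) := by
    intro p q
    rw [dotProduct_mulVec, ← mulVec_transpose, hA.eq, dotProduct_comm]
  refine exists_isWPNE_of_potential hY
    (fun y => L y ⬝ᵥ (A *ᵥ L y) / 2 +
      ∑ j, (X j (y j) ⬝ᵥ (A *ᵥ X j (y j)) / 2 + X j (y j) ⬝ᵥ b))
    (fun _ => 1) (fun _ => one_pos) fun y _ i y' _ => ?_
  have hsum := sum_update_sub_sum y i y'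
    (fun j v => X j v ⬝ᵥ (A *ᵥ X j v) / 2 + X j v ⬝ᵥ b)
  rw [hcost, hcost, hL (Function.update y i y') i, hL y i, otherLoad_update,
    Function.update_self]
  set z : Fin m → ℝ := fun r => (otherLoad w y i r : ℝ)
  simp only [mulVec_add, dotProduct_add, add_dotProduct]
  rw [hsymm z (X i y'), hsymm z (X i (y i))]
  linarith

theorem exists_isWPNE_of_exponential {n m : ℕ} {c : (Fin m → NNReal) → Fin m → ℝ}
    {w : Fin n → NNReal} (hw : ∀ i, 0 < w i) {Y : Fin n → Finset (Fin m → ℕ)}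
    (hY : IsStrategySets Y) {φ : ℝ} (hφ : φ ≠ 0) (a b : Fin m → ℝ)
    (hc : ∀ x r, c x r = a r * Real.exp (φ * (x r : ℝ)) + b r) :
    ∃ y, IsWPNE c w Y y := by
  have hw' : ∀ i, (0 : ℝ) < w i := fun i => by exact_mod_cast hw i
  let μ : Fin n → ℝ := fun i => 1 - Real.exp (-(φ * w i))
  have hμ : ∀ i, 0 < φ * μ i := by
    intro i
    rcases lt_or_gt_of_ne hφ with h | h
    · refine mul_pos_of_neg_of_neg h (sub_neg.2 (Real.one_lt_exp_iff.2 ?_))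
      nlinarith [hw' i]
    · refine mul_pos h (sub_pos.2 (Real.exp_lt_one_iff.2 ?_))
      nlinarith [hw' i]
  have hexp : ∀ y, (∀ i, y i ∈ Y i) → ∀ i r,
      Real.exp (φ * (wloadVec w y r : ℝ)) = Real.exp (φ * (otherLoad w y i r : ℝ)) +
        (y i r : ℝ) * μ i * Real.exp (φ * (wloadVec w y r : ℝ)) := by
    intro y hy i r
    rw [wloadVec_eq w y i]
    have h01 := hY.2 i (y i) (hy i) r
    rcases Nat.le_one_iff_eq_zero_or_eq_one.1 h01 with h | h
    · simp [h]
    · simp only [h, μ, NNReal.coe_add, Nat.cast_one, mul_one,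
        mul_add, Real.exp_add, Real.exp_neg]
      field_simp
      ring
  refine exists_isWPNE_of_potential hY.1
    (fun y => φ * (∑ r, a r * Real.exp (φ * (wloadVec w y r : ℝ)) +
      ∑ j, μ j * ∑ r, (y j r : ℝ) * b r))
    (fun i => φ * μ i / w i) (fun i => div_pos (hμ i) (hw' i)) fun y hy i y' hy' => ?_
  have hy'' : ∀ j, Function.update y i y' j ∈ Y j := by
    intro j
    rcases eq_or_ne j i with rfl | hj
    · simpa using hy'
    · simpa [Function.update_of_ne hj] using hy j
  have hexpand : ∀ y, (∀ i, y i ∈ Y i) → ∑ r, a r * Real.exp (φ * (wloadVec w y r : ℝ)) =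
      ∑ r, a r * Real.exp (φ * (otherLoad w y i r : ℝ)) +
        μ i * ∑ r, (y i r : ℝ) * (a r * Real.exp (φ * (wloadVec w y r : ℝ))) := by
    intro y hy
    rw [Finset.mul_sum, ← Finset.sum_add_distrib]
    refine Finset.sum_congr rfl fun r _ => ?_
    linear_combination a r * hexp y hy i r
  have hcost : ∀ y, wPlayerCost c w y i = w i *
      (∑ r, (y i r : ℝ) * (a r * Real.exp (φ * (wloadVec w y r : ℝ))) +
        ∑ r, (y i r : ℝ) * b r) := by
    intro y
    rw [← Finset.sum_add_distrib, Finset.mul_sum]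
    refine Finset.sum_congr rfl fun r _ => ?_
    rw [hc]; ring
  have hsum := sum_update_sub_sum y i y' (fun j v => μ j * ∑ r, (v r : ℝ) * b r)
  rw [hexpand _ hy'', hexpand _ hy, hcost, hcost, otherLoad_update, Function.update_self]
  have := (hw' i).ne'
  field_simp
  linear_combination hsum

end Potential

section Characterization

/-- The cost of resource `r` as a function of its own load, all other loads being zero. -/
noncomputable def costSection {m : ℕ} (c : (Fin m → NNReal) → Fin m → ℝ) (r : Fin m) (t : ℝ) :
    ℝ := c (Pi.single r t.toNNReal) r

lemma continuous_costSection {m : ℕ} {c : (Fin m → NNReal) → Fin m → ℝ} (hc : Continuous c)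
    (r : Fin m) : Continuous (costSection c r) :=
  (continuous_apply r).comp (hc.comp ((continuous_singleLoad r).comp continuous_real_toNNReal))

lemma mixedDifference_section {m : ℕ} (c : (Fin m → NNReal) → Fin m → ℝ) (r : Fin m)
    (s v w : NNReal) : mixedDifference c v w (Pi.single r s) {r} {r} =
      costSection c r (s + v + w) - costSection c r (s + v) := by
  simp only [mixedDifference, Finset.sum_singleton, smul_nindicVec_singleton, costSection,
    ← Pi.single_add, ← NNReal.coe_add, Real.toNNReal_coe]

lemma WConsistent.exchangeIdentity {𝒞 : WCostFamily} (h : WConsistent 𝒞)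
    (hcomp : WClosedUnderComposition 𝒞) {m m' : ℕ} {c : (Fin m → NNReal) → Fin m → ℝ}
    (hc : c ∈ 𝒞 m) {c' : (Fin m' → NNReal) → Fin m' → ℝ} (hc' : c' ∈ 𝒞 m') (r : Fin m)
    (r' : Fin m') : ExchangeIdentity (costSection c r) (costSection c' r') := by
  intro s t v w hs ht hv hw
  lift s to NNReal using hs
  lift t to NNReal using ht
  lift v to NNReal using hv.le
  lift w to NNReal using hw.le
  have := h.mixedDifference_mul_eq hcomp (NNReal.coe_pos.1 hv) (NNReal.coe_pos.1 hw) hc hc'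
    (Pi.single r s) {r} {r} (Pi.single r' t) {r'} {r'}
  simpa only [mixedDifference_section, add_right_comm _ (w : ℝ) (v : ℝ)] using this

lemma WConsistent.exchangeIdentity_id {𝒞 : WCostFamily} (h : WConsistent 𝒞)
    (hcont : ∀ m : ℕ, ∀ c ∈ 𝒞 m, Continuous c)
    (hcomp : WClosedUnderComposition 𝒞) {m m' : ℕ} {c : (Fin m → NNReal) → Fin m → ℝ}
    (hc : c ∈ 𝒞 m) {c' : (Fin m' → NNReal) → Fin m' → ℝ} (hc' : c' ∈ 𝒞 m') (r : Fin m)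
    {a b : Fin m'} (hab : a ≠ b) (hne : c' (Pi.single b 1) a - c' 0 a ≠ 0) :
    ExchangeIdentity (costSection c r) id := by
  intro s t v w hs ht hv hw
  lift s to NNReal using hs
  lift v to NNReal using hv.le
  lift w to NNReal using hw.le
  have hcc := hcont m' c' hc'
  have hsym : ∀ w : NNReal, 0 < w → ∀ u S T,
      mixedDifference c' w w u S T = mixedDifference c' w w u T S :=
    fun w hw u S T => h.mixedDifference_comm hcomp hw hc' u S T
  have hcomm := cost_increment_comm hcc hsym hab 0
  rw [zero_add, zero_add] at hcomm
  have := h.mixedDifference_mul_eq hcomp (NNReal.coe_pos.1 hv) (NNReal.coe_pos.1 hw) hc hc'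
    (Pi.single r s) {r} {r} 0 {a} {b}
  rw [mixedDifference_section, mixedDifference_section] at this
  simp only [mixedDifference, Finset.sum_singleton, smul_nindicVec_singleton, zero_add] at this
  have ea := cost_add_single hcc hsym hab.symm (Pi.single a v) w
  have eb := cost_add_single hcc hsym hab (Pi.single b w) v
  rw [cost_increment_eq hcc hsym hab] at ea
  rw [cost_increment_eq hcc hsym hab.symm, hcomm] at eb
  rw [ea, eb] at this
  refine mul_left_cancel₀ hne ?_
  rw [add_right_comm (s : ℝ) (w : ℝ) (v : ℝ)] at this
  simp only [id]
  linear_combination this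

theorem WConsistent.affine_or_exponential {𝒞 : WCostFamily}
    (hcont : ∀ m : ℕ, ∀ c ∈ 𝒞 m, Continuous c) (hcomp : WClosedUnderComposition 𝒞)
    (h : WConsistent 𝒞) :
    (∀ m : ℕ, ∀ c ∈ 𝒞 m, ∃ A : Matrix (Fin m) (Fin m) ℝ, A.IsSymm ∧
      ∃ b : Fin m → ℝ, ∀ x : Fin m → NNReal, ∀ r : Fin m,
        c x r = (∑ s, A r s * (x s : ℝ)) + b r) ∨
    (∃ φ : ℝ, ∀ m : ℕ, ∀ c ∈ 𝒞 m, ∃ a b : Fin m → ℝ,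
      ∀ x : Fin m → NNReal, ∀ r : Fin m,
        c x r = a r * Real.exp (φ * (x r : ℝ)) + b r) := by
  have hsym : ∀ {m : ℕ} {c : (Fin m → NNReal) → Fin m → ℝ}, c ∈ 𝒞 m →
      ∀ w : NNReal, 0 < w → ∀ u S T,
        mixedDifference c w w u S T = mixedDifference c w w u T S :=
    fun hc w hw u S T => h.mixedDifference_comm hcomp hw hc u S T
  have hlinear : ∀ {m : ℕ} {c : (Fin m → NNReal) → Fin m → ℝ}, c ∈ 𝒞 m → ∀ x r,
      c x r = costSection c r (x r) +
        ∑ s ∈ univ.erase r, (c (Pi.single s 1) r - c 0 r) * (x s : ℝ) := by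
    intro m c hc x r
    simpa [costSection] using cost_eq_section_add_linear (hcont m c hc) (hsym hc) x r
  let 𝒮 : Set (ℝ → ℝ) := {f | ∃ m, ∃ c ∈ 𝒞 m, ∃ r, f = costSection c r}
  have h𝒮cont : ∀ f ∈ 𝒮, Continuous f := by
    rintro f ⟨m, c, hc, r, rfl⟩
    exact continuous_costSection (hcont m c hc) r
  have h𝒮 : ∀ f ∈ 𝒮, ∀ g ∈ 𝒮, ExchangeIdentity f g := by
    rintro f ⟨m, c, hc, r, rfl⟩ g ⟨m', c', hc', r', rfl⟩
    exact h.exchangeIdentity hcomp hc hc' r r'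
  have haffine : (∀ f ∈ 𝒮, ∀ x, 0 ≤ x → f x - f 0 = (f 1 - f 0) * x) →
      ∀ m : ℕ, ∀ c ∈ 𝒞 m, ∃ A : Matrix (Fin m) (Fin m) ℝ, A.IsSymm ∧
        ∃ b : Fin m → ℝ, ∀ x : Fin m → NNReal, ∀ r : Fin m,
          c x r = (∑ s, A r s * (x s : ℝ)) + b r := by
    intro hlin m c hc
    refine ⟨Matrix.of fun r s => c (Pi.single s 1) r - c 0 r, ?_, fun r => c 0 r, fun x r => ?_⟩
    · refine Matrix.IsSymm.ext fun r s => ?_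
      rcases eq_or_ne r s with rfl | hrs
      · rfl
      · simpa using cost_increment_comm (hcont m c hc) (hsym hc) hrs 0
    · have hr := hlin (costSection c r) ⟨m, c, hc, r, rfl⟩ (x r) (x r).coe_nonneg
      rw [hlinear hc x r, ← Finset.add_sum_erase univ _ (mem_univ r)]
      simp only [costSection, Real.toNNReal_one, Real.toNNReal_zero, Pi.single_zero,
        Matrix.of_apply] at hr ⊢
      linarith
  by_cases hoff : ∃ m, ∃ c ∈ 𝒞 m, ∃ a b : Fin m, a ≠ b ∧ c (Pi.single b 1) a - c 0 a ≠ 0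
  · obtain ⟨m', c', hc', a, b, hab, hne⟩ := hoff
    have hid : ∀ f ∈ 𝒮, ExchangeIdentity f id := by
      rintro f ⟨m, c, hc, r, rfl⟩
      exact h.exchangeIdentity_id hcont hcomp hc hc' r hab hne
    obtain ⟨φ, hφ⟩ := exists_common_exponent (insert id 𝒮)
      (by
        rintro f (rfl | hf)
        exacts [continuous_id, h𝒮cont f hf])
      (by
        rintro f (rfl | hf) g (rfl | hg)
        · intro s t v w _ _ _ _
          simp only [id]; ring
        · exact (hid g hg).symm
        · exact hid f hf
        · exact h𝒮 f hf g hg)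
    have hφ0 : φ = 0 := eq_zero_of_expPrimitive_linear fun x hx => by
      simpa using hφ id (Set.mem_insert _ _) x hx
    subst hφ0
    refine Or.inl (haffine fun f hf x hx => ?_)
    simpa [expPrimitive_zero_left] using hφ f (Set.mem_insert_of_mem _ hf) x hx
  push Not at hoff
  obtain ⟨φ, hφ⟩ := exists_common_exponent 𝒮 h𝒮cont h𝒮
  rcases eq_or_ne φ 0 with rfl | hφ0
  · refine Or.inl (haffine fun f hf x hx => ?_)
    simpa [expPrimitive_zero_left] using hφ f hf x hx
  refine Or.inr ⟨φ, fun m c hc => ?_⟩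
  let κ : Fin m → ℝ := fun r =>
    (costSection c r 1 - costSection c r 0) / expPrimitive φ 1 / φ
  refine ⟨κ, fun r => costSection c r 0 - κ r, fun x r => ?_⟩
  have hr := hφ (costSection c r) ⟨m, c, hc, r, rfl⟩ (x r) (x r).coe_nonneg
  have hE := expPrimitive_one_ne_zero φ
  rw [hlinear hc x r, Finset.sum_eq_zero fun s hs => by
    rw [hoff m c hc r s (Finset.ne_of_mem_erase hs).symm, zero_mul], add_zero]
  rw [expPrimitive_of_ne_zero hφ0 (x r : ℝ)] at hr
  simp only [κ]
  field_simp at hr ⊢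
  linarith

end Characterization

/-- Theorem 2 (characterization of consistency for weighted resource graph games):
a composition-closed set of continuous cost functions is consistent iff all of its members
are affine with symmetric linear part, or all of its members are separable exponential
functions with a common exponent. -/
theorem consistency_weighted_characterization (𝒞 : WCostFamily)
    (hcont : ∀ m : ℕ, ∀ c ∈ 𝒞 m, Continuous c)
    (hcomp : WClosedUnderComposition 𝒞) :
    WConsistent 𝒞 ↔
      ((∀ m : ℕ, ∀ c ∈ 𝒞 m, ∃ A : Matrix (Fin m) (Fin m) ℝ, A.IsSymm ∧
          ∃ b : Fin m → ℝ, ∀ x : Fin m → NNReal, ∀ r : Fin m,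
            c x r = (∑ s, A r s * (x s : ℝ)) + b r) ∨
        (∃ φ : ℝ, ∀ m : ℕ, ∀ c ∈ 𝒞 m, ∃ a b : Fin m → ℝ,
          ∀ x : Fin m → NNReal, ∀ r : Fin m,
            c x r = a r * Real.exp (φ * (x r : ℝ)) + b r)) := by
  refine ⟨fun h => h.affine_or_exponential hcont hcomp, ?_⟩
  rintro (haff | ⟨φ, hexp⟩) m c hc n w hw Y hY
  · obtain ⟨A, hA, b, hb⟩ := haff m c hc
    exact exists_isWPNE_of_affine hY.1 A hA b hb
  · obtain ⟨a, b, hab⟩ := hexp m c hc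
    rcases eq_or_ne φ 0 with rfl | hφ
    · exact exists_isWPNE_of_affine hY.1 0 Matrix.isSymm_zero (fun r => a r + b r)
        fun x r => by simp [hab]
    · exact exists_isWPNE_of_exponential hw hY hφ a b hab
end

section
/- Let G be a weighted resource graph game on m resources whose cost function c : ℝ_{≥0}^m → ℝ^m is given by c(x) = A x + b, where A ∈ ℝ^{m×m} is a symmetric matrix and b ∈ ℝ^m is a vector. Then G has a pure Nash equilibrium. -/
open Finset NNReal

open scoped Matrix in
/-- Twice the exact potential of the game with affine cost `x ↦ A x + b`, as a function of the
real strategy vectors `X i`. -/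
def affinePotential {n m : ℕ} (A : Matrix (Fin m) (Fin m) ℝ) (b : Fin m → ℝ)
    (X : Fin n → Fin m → ℝ) : ℝ :=
  (∑ j, X j) ⬝ᵥ A *ᵥ (∑ j, X j) + ∑ j, X j ⬝ᵥ A *ᵥ X j + 2 * (b ⬝ᵥ ∑ j, X j)

open scoped Matrix in
/-- Up to a term independent of the strategy of player `i`, the potential is twice the private
cost of player `i`. -/
lemma affinePotential_eq {n m : ℕ} {A : Matrix (Fin m) (Fin m) ℝ} (hA : A.IsSymm)
    (b : Fin m → ℝ) (X : Fin n → Fin m → ℝ) (i : Fin n) :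
    affinePotential A b X = 2 * (X i ⬝ᵥ (A *ᵥ (∑ j, X j) + b)) +
      ((∑ j ∈ univ.erase i, X j) ⬝ᵥ A *ᵥ (∑ j ∈ univ.erase i, X j) +
        ∑ j ∈ univ.erase i, X j ⬝ᵥ A *ᵥ X j + 2 * (b ⬝ᵥ ∑ j ∈ univ.erase i, X j)) := by
  unfold affinePotential
  rw [← add_sum_erase univ X (mem_univ i),
    ← add_sum_erase univ (fun j => X j ⬝ᵥ A *ᵥ X j) (mem_univ i)]
  generalize ∑ j ∈ univ.erase i, X j = z
  have hsymm : z ⬝ᵥ A *ᵥ X i = X i ⬝ᵥ A *ᵥ z := by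
    rw [Matrix.dotProduct_mulVec, ← Matrix.mulVec_transpose, hA.eq, dotProduct_comm]
  simp only [Matrix.mulVec_add, dotProduct_add, add_dotProduct, hsymm, dotProduct_comm b (X i)]
  ring

open scoped Matrix in
/-- The private cost in a game with affine cost function, in vector notation. -/
lemma wPlayerCost_affine {n m : ℕ} {A : Matrix (Fin m) (Fin m) ℝ} {b : Fin m → ℝ}
    {c : (Fin m → NNReal) → Fin m → ℝ}
    (hc : ∀ x r, c x r = (∑ s, A r s * (x s : ℝ)) + b r)
    (w : Fin n → NNReal) (y : Fin n → Fin m → ℕ) (i : Fin n) :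
    wPlayerCost c w y i = (fun r => (w i : ℝ) * (y i r : ℝ)) ⬝ᵥ
      (A *ᵥ (∑ j, fun r => (w j : ℝ) * (y j r : ℝ)) + b) := by
  simp [wPlayerCost, hc, wloadVec, dotProduct, Matrix.mulVec]

/-- Lemma: every weighted resource graph game whose cost function is affine with a
symmetric matrix has a pure Nash equilibrium. -/
theorem exists_pne_weighted_affine (m n : ℕ)
    (A : Matrix (Fin m) (Fin m) ℝ) (hA : A.IsSymm) (b : Fin m → ℝ)
    (c : (Fin m → NNReal) → Fin m → ℝ)
    (hc : ∀ x r, c x r = (∑ s, A r s * (x s : ℝ)) + b r)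
    (w : Fin n → NNReal) (hw : ∀ i, 0 < w i)
    (Y : Fin n → Finset (Fin m → ℕ)) (hY : IsStrategySets Y) :
    ∃ y, IsWPNE c w Y y := by
  classical
  set X : (Fin n → Fin m → ℕ) → Fin n → Fin m → ℝ := fun y j r => (w j : ℝ) * (y j r : ℝ) with hX
  obtain ⟨y, hy, hmin⟩ := (Fintype.piFinset Y).exists_min_image
    (fun y => affinePotential A b (X y)) (Fintype.piFinset_nonempty.2 hY.1)
  rw [Fintype.mem_piFinset] at hy
  refine ⟨y, hy, fun i y' hy' => ?_⟩
  have hmem : Function.update y i y' ∈ Fintype.piFinset Y := by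
    rw [Fintype.mem_piFinset]
    intro j
    obtain rfl | hj := eq_or_ne j i
    · simpa using hy'
    · simpa [hj] using hy j
  have hle := hmin _ hmem
  have hoff : ∀ j ∈ univ.erase i, X (Function.update y i y') j = X y j := by
    intro j hj
    simp [hX, Finset.ne_of_mem_erase hj]
  simp only [affinePotential_eq hA b _ i] at hle
  have hquad : ∑ j ∈ univ.erase i, X (Function.update y i y') j ⬝ᵥ
      A.mulVec (X (Function.update y i y') j) =
      ∑ j ∈ univ.erase i, X y j ⬝ᵥ A.mulVec (X y j) :=
    sum_congr rfl fun j hj => by rw [hoff j hj]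
  rw [sum_congr rfl hoff, hquad] at hle
  rw [wPlayerCost_affine hc, wPlayerCost_affine hc]
  exact le_of_mul_le_mul_left (le_of_add_le_add_right hle) two_pos
end

section
/- Let 𝒞 be a set of cost functions that is closed under composition and consistent for weighted resource graph games. Then for every c ∈ 𝒞 with c : ℝ_{≥0}^m → ℝ^m, for all r, s ∈ {1,…,m}, all x ∈ ℝ_{≥0}^m, and all ε > 0, it holds that c_r(x + ε·1_{{r,s}}) − c_r(x + ε·1_r) = c_s(x + ε·1_{{r,s}}) − c_s(x + ε·1_s). -/
open Finset NNReal

/-- The private cost for a composed cost function is the sum of the private costs in the two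
components. -/
theorem wPlayerCost_woplus {n m m' : ℕ} (c : (Fin m → NNReal) → Fin m → ℝ)
    (c' : (Fin m' → NNReal) → Fin m' → ℝ) (w : Fin n → NNReal)
    (y : Fin n → Fin m → ℕ) (y' : Fin n → Fin m' → ℕ) (i : Fin n) :
    wPlayerCost (woplus c c') w (fun j => Fin.append (y j) (y' j)) i
      = wPlayerCost c w y i + wPlayerCost c' w y' i := by
  simp [wPlayerCost, woplus, wloadVec, Fin.sum_univ_add]
  rfl

/-- A profile of two active players followed by one background player per resource. -/
def twoPlayerProfile {m : ℕ} {α : Type*} (a b : α) (g : Fin m → α) : Fin (m + 2) → α :=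
  Fin.cons a (Fin.cons b g)

section twoPlayerProfile

variable {m : ℕ} {α : Type*} (a b : α) (g : Fin m → α)

@[simp] theorem twoPlayerProfile_zero : twoPlayerProfile a b g 0 = a := rfl

@[simp] theorem twoPlayerProfile_one : twoPlayerProfile a b g 1 = b := rfl

@[simp] theorem twoPlayerProfile_succ_succ (j : Fin m) :
    twoPlayerProfile a b g j.succ.succ = g j := rfl

theorem forall_fin_add_two {P : Fin (m + 2) → Prop} :
    (∀ i, P i) ↔ P 0 ∧ P 1 ∧ ∀ j : Fin m, P j.succ.succ := by
  rw [Fin.forall_fin_succ, Fin.forall_fin_succ]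
  rfl

theorem update_twoPlayerProfile_zero (a' : α) :
    Function.update (twoPlayerProfile a b g) 0 a' = twoPlayerProfile a' b g :=
  Fin.update_cons_zero _ _ _

theorem update_twoPlayerProfile_one (b' : α) :
    Function.update (twoPlayerProfile a b g) 1 b' = twoPlayerProfile a b' g := by
  refine funext (forall_fin_add_two.2 ⟨by simp, by simp, fun j => ?_⟩)
  rw [Function.update_of_ne (by simp [Fin.ext_iff])]
  rfl

end twoPlayerProfile

theorem twoPlayerProfile_append {m k k' : ℕ} (a b : Fin k → ℕ) (a' b' : Fin k' → ℕ)
    (g : Fin m → Fin k → ℕ) (g' : Fin m → Fin k' → ℕ) :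
    twoPlayerProfile (Fin.append a a') (Fin.append b b') (fun j => Fin.append (g j) (g' j))
      = fun i => Fin.append (twoPlayerProfile a b g i) (twoPlayerProfile a' b' g' i) :=
  funext (forall_fin_add_two.2 ⟨rfl, rfl, fun _ => rfl⟩)

/-- The weights of two active players of weight `ε` and of background players that
generate the load `x`; a background player without load gets weight `1`. -/
noncomputable def loadWeights {m : ℕ} (x : Fin m → NNReal) (ε : NNReal) :
    Fin (m + 2) → NNReal :=
  twoPlayerProfile ε ε (fun j => if x j = 0 then 1 else x j)

@[simp] theorem loadWeights_zero {m : ℕ} (x : Fin m → NNReal) (ε : NNReal) :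
    loadWeights x ε 0 = ε := rfl

@[simp] theorem loadWeights_one {m : ℕ} (x : Fin m → NNReal) (ε : NNReal) :
    loadWeights x ε 1 = ε := rfl

/-- The only strategy of the background player `j`: use resource `j` if it has positive load. -/
noncomputable def loadStrategy {m : ℕ} (x : Fin m → NNReal) (j : Fin m) : Fin m → ℕ :=
  if x j = 0 then 0 else Pi.single j 1

theorem loadStrategy_le_one {m : ℕ} (x : Fin m → NNReal) (j t : Fin m) :
    loadStrategy x j t ≤ 1 := by
  unfold loadStrategy
  split_ifs
  · simp
  · rw [Pi.single_apply]; split_ifs <;> simp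

theorem loadWeights_pos {m : ℕ} (x : Fin m → NNReal) {ε : NNReal} (hε : 0 < ε) :
    ∀ i, 0 < loadWeights x ε i := by
  refine forall_fin_add_two.2 ⟨hε, hε, fun j => ?_⟩
  change 0 < if x j = 0 then 1 else x j
  split_ifs with h
  · exact one_pos
  · exact pos_iff_ne_zero.2 h

theorem wloadVec_loadWeights {m : ℕ} (x : Fin m → NNReal) (ε : NNReal) (u v : Fin m → ℕ) :
    wloadVec (loadWeights x ε) (twoPlayerProfile u v (loadStrategy x))
      = fun t => x t + ε * (u t + v t) := by
  funext t
  have h : ∀ j, (if x j = 0 then 1 else x j) * (loadStrategy x j t : NNReal)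
      = if t = j then x j else 0 := by
    intro j
    by_cases hj : x j = 0 <;> by_cases ht : t = j <;> simp [loadStrategy, hj, ht]
  have hsum : wloadVec (loadWeights x ε) (twoPlayerProfile u v (loadStrategy x)) t
      = ε * u t + (ε * v t
        + ∑ j, (if x j = 0 then 1 else x j) * (loadStrategy x j t : NNReal)) := by
    unfold wloadVec
    rw [Fin.sum_univ_succ, Fin.sum_univ_succ]
    rfl
  rw [hsum]
  simp only [h, Finset.sum_ite_eq, Finset.mem_univ, if_true]
  ring

section playerCost

variable {m : ℕ} (c : (Fin m → NNReal) → Fin m → ℝ) (x : Fin m → NNReal) (ε : NNReal)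

theorem load_single_single {r s : Fin m} (h : r ≠ s) :
    (fun t => x t + ε * (((Pi.single r 1 : Fin m → ℕ) t : NNReal)
      + ((Pi.single s 1 : Fin m → ℕ) t : NNReal))) = x + ε • nindicVec {r, s} := by
  funext t
  by_cases hr : t = r
  · subst hr; simp [nindicVec, h]
  · by_cases hs : t = s <;> simp [nindicVec, hr, hs, h.symm]

theorem load_single {r : Fin m} :
    (fun t => x t + ε * ((Pi.single r 1 : Fin m → ℕ) t : NNReal))
      = x + ε • nindicVec {r} := by
  funext t
  by_cases hr : t = r <;> simp [nindicVec, hr]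

theorem wPlayerCost_single {n : ℕ} (w : Fin n → NNReal) (y : Fin n → Fin m → ℕ) (i : Fin n)
    (r : Fin m) (h : y i = Pi.single r 1) :
    wPlayerCost c w y i = w i * c (wloadVec w y) r := by
  simp [wPlayerCost, h, Pi.single_apply]

theorem wPlayerCost_zero_idle (v : Fin m → ℕ) :
    wPlayerCost c (loadWeights x ε) (twoPlayerProfile 0 v (loadStrategy x)) 0 = 0 := by
  simp [wPlayerCost]

theorem wPlayerCost_one_idle (u : Fin m → ℕ) :
    wPlayerCost c (loadWeights x ε) (twoPlayerProfile u 0 (loadStrategy x)) 1 = 0 := by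
  simp [wPlayerCost]

theorem wPlayerCost_zero_pair {r s : Fin m} (h : r ≠ s) :
    wPlayerCost c (loadWeights x ε)
      (twoPlayerProfile (Pi.single r 1) (Pi.single s 1) (loadStrategy x)) 0
      = ε * c (x + ε • nindicVec {r, s}) r := by
  rw [wPlayerCost_single _ _ _ _ _ rfl, wloadVec_loadWeights, load_single_single x ε h]
  rfl

theorem wPlayerCost_one_pair {r s : Fin m} (h : r ≠ s) :
    wPlayerCost c (loadWeights x ε)
      (twoPlayerProfile (Pi.single r 1) (Pi.single s 1) (loadStrategy x)) 1
      = ε * c (x + ε • nindicVec {r, s}) s := by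
  rw [wPlayerCost_single _ _ _ _ _ rfl, wloadVec_loadWeights, load_single_single x ε h]
  rfl

theorem wPlayerCost_zero_alone (r : Fin m) :
    wPlayerCost c (loadWeights x ε)
      (twoPlayerProfile (Pi.single r 1) 0 (loadStrategy x)) 0
      = ε * c (x + ε • nindicVec {r}) r := by
  rw [wPlayerCost_single _ _ _ _ _ rfl, wloadVec_loadWeights]
  simp [load_single]

theorem wPlayerCost_one_alone (s : Fin m) :
    wPlayerCost c (loadWeights x ε)
      (twoPlayerProfile 0 (Pi.single s 1) (loadStrategy x)) 1
      = ε * c (x + ε • nindicVec {s}) s := by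
  rw [wPlayerCost_single _ _ _ _ _ rfl, wloadVec_loadWeights]
  simp [load_single]

end playerCost

/-- The `0/1`-vector on four copies of the resources given by its restrictions. -/
def appendFour {m : ℕ} (a b c d : Fin m → ℕ) : Fin ((m + m) + (m + m)) → ℕ :=
  Fin.append (Fin.append a b) (Fin.append c d)

theorem appendFour_le_one {m : ℕ} {a b c d : Fin m → ℕ} (ha : ∀ t, a t ≤ 1)
    (hb : ∀ t, b t ≤ 1) (hc : ∀ t, c t ≤ 1) (hd : ∀ t, d t ≤ 1) (t) :
    appendFour a b c d t ≤ 1 := by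
  unfold appendFour
  refine Fin.addCases (fun t => ?_) (fun t => ?_) t <;>
    refine Fin.addCases (fun t => ?_) (fun t => ?_) t <;>
    simp only [Fin.append_left, Fin.append_right, ha, hb, hc, hd]

theorem wPlayerCost_appendFour {m : ℕ} (c : (Fin m → NNReal) → Fin m → ℝ)
    (w : Fin (m + 2) → NNReal) (g : Fin m → Fin m → ℕ)
    (u₁ u₂ u₃ u₄ v₁ v₂ v₃ v₄ : Fin m → ℕ) (i : Fin (m + 2)) :
    wPlayerCost (woplus (woplus c c) (woplus c c)) w
      (twoPlayerProfile (appendFour u₁ u₂ u₃ u₄) (appendFour v₁ v₂ v₃ v₄)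
        (fun j => appendFour (g j) (g j) (g j) (g j))) i
      = wPlayerCost c w (twoPlayerProfile u₁ v₁ g) i
        + wPlayerCost c w (twoPlayerProfile u₂ v₂ g) i
        + (wPlayerCost c w (twoPlayerProfile u₃ v₃ g) i
        + wPlayerCost c w (twoPlayerProfile u₄ v₄ g) i) := by
  simp only [appendFour, twoPlayerProfile_append, wPlayerCost_woplus]

/-- Lemma (part (a)): symmetry of mutual influences for weighted consistency. -/
theorem symmetric_jacobi_weighted (𝒞 : WCostFamily)
    (hcomp : WClosedUnderComposition 𝒞) (hcons : WConsistent 𝒞)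
    (m : ℕ) (c : (Fin m → NNReal) → Fin m → ℝ) (hc : c ∈ 𝒞 m)
    (r s : Fin m) (x : Fin m → NNReal) (ε : NNReal) (hε : 0 < ε) :
    c (x + ε • nindicVec {r, s}) r - c (x + ε • nindicVec {r}) r
      = c (x + ε • nindicVec {r, s}) s - c (x + ε • nindicVec {s}) s := by
  rcases eq_or_ne r s with rfl | hrs
  · rfl
  let R : Fin m → ℕ := Pi.single r 1
  let S : Fin m → ℕ := Pi.single s 1
  have hR : ∀ t, R t ≤ 1 := fun t => by
    simp only [R, Pi.single_apply]; split_ifs <;> simp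
  have hS : ∀ t, S t ≤ 1 := fun t => by
    simp only [S, Pi.single_apply]; split_ifs <;> simp
  have h0 : ∀ t, (0 : Fin m → ℕ) t ≤ 1 := fun t => by simp
  let g : Fin m → Fin ((m + m) + (m + m)) → ℕ := fun j =>
    appendFour (loadStrategy x j) (loadStrategy x j) (loadStrategy x j) (loadStrategy x j)
  -- Sharing a copy means `r` against `s` for matching choices and `s` against `r` otherwise.
  let a₁ := appendFour R 0 S 0
  let a₂ := appendFour 0 R 0 S
  let b₁ := appendFour S 0 0 R
  let b₂ := appendFour 0 S R 0
  obtain ⟨y, hy, hN⟩ := hcons _ _ (hcomp _ _ _ (hcomp _ _ _ hc _ hc) _ (hcomp _ _ _ hc _ hc))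
    (m + 2) (loadWeights x ε) (loadWeights_pos x hε)
    (twoPlayerProfile {a₁, a₂} {b₁, b₂} (fun j => {g j}))
    ⟨forall_fin_add_two.2 ⟨by simp, by simp, by simp⟩, forall_fin_add_two.2
      ⟨by
        simp only [twoPlayerProfile_zero, Finset.mem_insert, Finset.mem_singleton]
        rintro v (rfl | rfl)
        exacts [appendFour_le_one hR h0 hS h0, appendFour_le_one h0 hR h0 hS],
      by
        simp only [twoPlayerProfile_one, Finset.mem_insert, Finset.mem_singleton]
        rintro v (rfl | rfl)
        exacts [appendFour_le_one hS h0 h0 hR, appendFour_le_one h0 hS hR h0],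
      by
        intro j
        simp only [twoPlayerProfile_succ_succ, Finset.mem_singleton]
        rintro v rfl
        have h := loadStrategy_le_one x j
        exact appendFour_le_one h h h h⟩⟩
  obtain ⟨hy0, hy1, hyg⟩ := forall_fin_add_two.1 hy
  simp only [twoPlayerProfile_zero, twoPlayerProfile_one, twoPlayerProfile_succ_succ,
    Finset.mem_insert, Finset.mem_singleton] at hy0 hy1 hyg
  have hprofile : y = twoPlayerProfile (y 0) (y 1) g :=
    funext (forall_fin_add_two.2 ⟨rfl, rfl, hyg⟩)
  have hN0 := hN 0
  have hN1 := hN 1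
  rw [hprofile] at hN0 hN1
  simp only [twoPlayerProfile_zero, twoPlayerProfile_one, Finset.mem_insert,
    Finset.mem_singleton, forall_eq_or_imp, forall_eq, update_twoPlayerProfile_zero,
    update_twoPlayerProfile_one] at hN0 hN1
  have hε' : (0 : ℝ) < ε := hε
  have hcommon : {s, r} = ({r, s} : Finset (Fin m)) := Finset.pair_comm s r
  rcases hy0 with h | h <;> rcases hy1 with h' | h' <;>
    simp only [h, h', a₁, a₂, b₁, b₂, g, R, S, wPlayerCost_appendFour, wPlayerCost_zero_idle,
      wPlayerCost_one_idle, wPlayerCost_zero_pair c x ε hrs, wPlayerCost_one_pair c x ε hrs,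
      wPlayerCost_zero_pair c x ε hrs.symm, wPlayerCost_one_pair c x ε hrs.symm,
      wPlayerCost_zero_alone, wPlayerCost_one_alone, hcommon] at hN0 hN1 <;>
    refine mul_left_cancel₀ hε'.ne' ?_ <;>
    linarith [hN0.1, hN0.2, hN1.1, hN1.2]
end

section
/- Let 𝒞 be a set of continuous cost functions that is closed under composition and consistent for weighted resource graph games. Then for every c ∈ 𝒞 with c : ℝ_{≥0}^m → ℝ^m for some m ∈ ℕ, one of the following holds: (a) for every subset S ⊆ {1,…,m} and every z ∈ ℝ_{≥0}^m there exist a_{S,z}, b_{S,z} ∈ ℝ such that Σ_{r∈S} c_r(z + λ·1_S) = a_{S,z} λ + b_{S,z} for all λ ≥ 0; or (b) there exists φ ∈ ℝ such that for every subset S ⊆ {1,…,m} and every z ∈ ℝ_{≥0}^m there exist a_{S,z}, b_{S,z} ∈ ℝ such that Σ_{r∈S} c_r(z + λ·1_S) = a_{S,z} exp(φ λ) + b_{S,z} for all λ ≥ 0. -/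
open Finset NNReal

/-- The cost of the set of resources `S`, as a function of a common additional load `lam` on top
of the background load `z`. -/
noncomputable def diagCost {m : ℕ} (c : (Fin m → NNReal) → Fin m → ℝ) (S : Finset (Fin m))
    (z : Fin m → NNReal) (lam : NNReal) : ℝ :=
  ∑ r ∈ S, c (z + lam • nindicVec S) r

theorem continuous_diagCost {m : ℕ} {c : (Fin m → NNReal) → Fin m → ℝ} (hc : Continuous c)
    (S : Finset (Fin m)) (z : Fin m → NNReal) : Continuous (diagCost c S z) := by
  unfold diagCost
  fun_prop

theorem diagCost_add {m : ℕ} (c : (Fin m → NNReal) → Fin m → ℝ) (S : Finset (Fin m))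
    (z : Fin m → NNReal) (t lam : NNReal) :
    diagCost c S (z + t • nindicVec S) lam = diagCost c S z (t + lam) := by
  simp only [diagCost, add_smul, add_assoc]

/-- Colour `(i, j)` is used by the first player when choosing `i` and by the second player when
choosing `j`; `H p` is the aggregated cost of the resources of colour `p`. -/
def Realizable (𝒞 : WCostFamily) (H : Bool × Bool → NNReal → ℝ) : Prop :=
  ∃ M : ℕ, ∃ C ∈ 𝒞 M, ∃ z : Fin M → NNReal, ∃ κ : Fin M → Option (Bool × Bool),
    ∀ lam : Bool × Bool → NNReal, ∀ p,
      ∑ r, (if κ r = some p then C (fun r => z r + (κ r).elim 0 lam) r else 0) = H p (lam p)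

theorem Realizable.single {𝒞 : WCostFamily} {m : ℕ} {c : (Fin m → NNReal) → Fin m → ℝ}
    (hc : c ∈ 𝒞 m) (S : Finset (Fin m)) (z : Fin m → NNReal) (p : Bool × Bool) :
    Realizable 𝒞 (Pi.single p (diagCost c S z)) := by
  refine ⟨m, c, hc, z, fun r => if r ∈ S then some p else none, fun lam q => ?_⟩
  by_cases hq : q = p
  · subst hq
    have hload : (fun r => z r + (if r ∈ S then some q else none : Option (Bool × Bool)).elim 0 lam)
        = z + lam q • nindicVec S := by
      funext r
      by_cases hr : r ∈ S <;> simp [hr, nindicVec]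
    simp [hload, diagCost]
  · have hq' : ¬ p = q := fun h => hq h.symm
    simp [hq, hq']

theorem Realizable.zero {𝒞 : WCostFamily} {m : ℕ} {c : (Fin m → NNReal) → Fin m → ℝ}
    (hc : c ∈ 𝒞 m) : Realizable 𝒞 0 :=
  ⟨m, c, hc, 0, fun _ => none, fun lam p => by simp⟩

theorem Realizable.add {𝒞 : WCostFamily} (hcomp : WClosedUnderComposition 𝒞)
    {H H' : Bool × Bool → NNReal → ℝ} (h : Realizable 𝒞 H) (h' : Realizable 𝒞 H') :
    Realizable 𝒞 (H + H') := by
  obtain ⟨M, C, hC, z, κ, hH⟩ := h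
  obtain ⟨M', C', hC', z₂, κ', hH₂⟩ := h'
  refine ⟨M + M', woplus C C', hcomp _ _ _ hC _ hC', Fin.append z z₂, Fin.append κ κ',
    fun lam p => ?_⟩
  rw [Fin.sum_univ_add]
  simp only [woplus, Fin.append_left, Fin.append_right, Fin.addCases_left, Fin.addCases_right,
    Pi.add_apply, hH, hH₂]

/-- The realizable families of aggregated costs form an additive submonoid. -/
def realizableSubmonoid {𝒞 : WCostFamily} (hcomp : WClosedUnderComposition 𝒞) {m : ℕ}
    {c : (Fin m → NNReal) → Fin m → ℝ} (hc : c ∈ 𝒞 m) :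
    AddSubmonoid (Bool × Bool → NNReal → ℝ) where
  carrier := {H | Realizable 𝒞 H}
  zero_mem' := Realizable.zero hc
  add_mem' := fun h h' => h.add hcomp h'

theorem Realizable.nsmul_add_nsmul {𝒞 : WCostFamily} (hcomp : WClosedUnderComposition 𝒞) {m : ℕ}
    {c : (Fin m → NNReal) → Fin m → ℝ} (hc : c ∈ 𝒞 m) (S T : Finset (Fin m))
    (z z₂ : Fin m → NNReal) (k l : Bool × Bool → ℕ) :
    Realizable 𝒞 (fun p => k p • diagCost c S z + l p • diagCost c T z₂) := by
  have key : ∀ (S : Finset (Fin m)) (z : Fin m → NNReal) (k : Bool × Bool → ℕ),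
      (fun p => k p • diagCost c S z) ∈ realizableSubmonoid hcomp hc := by
    intro S z k
    rw [← Finset.univ_sum_single (fun p => k p • diagCost c S z)]
    refine sum_mem fun p _ => ?_
    rw [Pi.single_smul]
    exact nsmul_mem (Realizable.single hc S z p) _
  exact (realizableSubmonoid hcomp hc).add_mem (key S z k) (key T z₂ l)

/-- In a consistent family, the two-player game with background load attached to a realizable
family of costs has an equilibrium. -/
theorem Realizable.exists_equilibrium {𝒞 : WCostFamily} (hcons : WConsistent 𝒞)
    {H : Bool × Bool → NNReal → ℝ} (h : Realizable 𝒞 H) {x y : NNReal} (hx : 0 < x) (hy : 0 < y) :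
    ∃ i j : Bool,
      H (i, j) (x + y) + H (i, !j) x ≤ H (!i, j) (x + y) + H (!i, !j) x ∧
      H (i, j) (x + y) + H (!i, j) y ≤ H (i, !j) (x + y) + H (!i, !j) y := by
  obtain ⟨M, C, hC, z, κ, hH⟩ := h
  let u : Bool → Fin M → ℕ := fun i r =>
    if κ r = some (i, true) ∨ κ r = some (i, false) then 1 else 0
  let v : Bool → Fin M → ℕ := fun j r =>
    if κ r = some (true, j) ∨ κ r = some (false, j) then 1 else 0
  let bg : Fin M → Fin M → ℕ := fun k r => if z k = 0 then 0 else if k = r then 1 else 0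
  let wb : Fin M → NNReal := fun k => if z k = 0 then 1 else z k
  let w : Fin (M + 2) → NNReal := Fin.cons x (Fin.cons y wb)
  let Y : Fin (M + 2) → Finset (Fin M → ℕ) :=
    Fin.cons (univ.image u) (Fin.cons (univ.image v) fun k => {bg k})
  let prof : Bool → Bool → Fin (M + 2) → Fin M → ℕ :=
    fun i j => Fin.cons (u i) (Fin.cons (v j) bg)
  have hw : ∀ k, 0 < w k := by
    refine Fin.cases hx (Fin.cases hy fun k => ?_)
    change 0 < wb k
    by_cases hz : z k = 0
    · simp [wb, hz]
    · simpa [wb, hz] using pos_iff_ne_zero.2 hz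
  have hY : IsStrategySets Y := by
    constructor
    · refine Fin.cases ?_ (Fin.cases ?_ fun k => ?_)
      · simp [Y]
      · change (univ.image v).Nonempty
        simp
      · exact Finset.singleton_nonempty _
    · refine Fin.cases ?_ (Fin.cases ?_ fun k => ?_)
      · intro s hs r
        obtain ⟨i, -, rfl⟩ := Finset.mem_image.1 hs
        simp only [u]; split_ifs <;> simp
      · intro s hs r
        obtain ⟨i, -, rfl⟩ := Finset.mem_image.1 (show s ∈ univ.image v from hs)
        simp only [v]; split_ifs <;> simp
      · intro s hs r
        obtain rfl := Finset.mem_singleton.1 (show s ∈ ({bg k} : Finset _) from hs)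
        simp only [bg]; split_ifs <;> simp
  let load : Bool → Bool → Bool × Bool → NNReal := fun i j p =>
    (if p.1 = i then x else 0) + (if p.2 = j then y else 0)
  have hload : ∀ i j, wloadVec w (prof i j) = fun r => z r + (κ r).elim 0 (load i j) := by
    intro i j
    funext r
    have hb : ∑ k, wb k * (bg k r : NNReal) = z r := by
      rw [Finset.sum_eq_single r]
      · by_cases hz : z r = 0 <;> simp [wb, bg, hz]
      · intro k _ hk
        simp [bg, hk]
      · simp
    simp only [wloadVec, Fin.sum_univ_succ, w, prof, Fin.cons_zero, Fin.cons_succ, hb]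
    rcases hκ : κ r with _ | ⟨a, b⟩
    · simp [u, v, hκ]
    · revert hκ
      cases i <;> cases j <;> cases a <;> cases b <;> intro hκ <;> simp [u, v, hκ, load] <;> ring
  have hcost₁ : ∀ i j, wPlayerCost C w (prof i j) 0 =
      x * (H (i, j) (x + y) + H (i, !j) x) := by
    intro i j
    have h₁ : H (i, j) (x + y) = H (i, j) (load i j (i, j)) := by simp [load]
    have h₂ : H (i, !j) x = H (i, !j) (load i j (i, !j)) := by simp [load]
    rw [h₁, h₂, ← hH, ← hH, ← Finset.sum_add_distrib, Finset.mul_sum, wPlayerCost, hload]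
    refine Finset.sum_congr rfl fun r _ => ?_
    simp only [w, prof, Fin.cons_zero, u]
    rcases hκ : κ r with _ | ⟨a, b⟩
    · simp
    · cases i <;> cases j <;> cases a <;> cases b <;> simp
  have hcost₂ : ∀ i j, wPlayerCost C w (prof i j) 1 =
      y * (H (i, j) (x + y) + H (!i, j) y) := by
    intro i j
    have h₁ : H (i, j) (x + y) = H (i, j) (load i j (i, j)) := by simp [load]
    have h₂ : H (!i, j) y = H (!i, j) (load i j (!i, j)) := by simp [load]
    rw [h₁, h₂, ← hH, ← hH, ← Finset.sum_add_distrib, Finset.mul_sum, wPlayerCost, hload]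
    refine Finset.sum_congr rfl fun r _ => ?_
    have hw1 : w 1 = y := rfl
    have hp1 : prof i j 1 = v j := rfl
    rw [hw1, hp1]
    simp only [v]
    rcases hκ : κ r with _ | ⟨a, b⟩
    · simp
    · cases i <;> cases j <;> cases a <;> cases b <;> simp
  obtain ⟨s, hs, hmin⟩ := hcons M C hC (M + 2) w hw Y hY
  obtain ⟨i, -, hi⟩ := Finset.mem_image.1 (show s 0 ∈ univ.image u from hs 0)
  obtain ⟨j, -, hj⟩ := Finset.mem_image.1 (show s 1 ∈ univ.image v from hs 1)
  have hprof : s = prof i j := by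
    funext k
    refine Fin.cases hi.symm (Fin.cases hj.symm fun k => ?_) k
    exact Finset.mem_singleton.1 (show s k.succ.succ ∈ ({bg k} : Finset _) from hs k.succ.succ)
  subst hprof
  have hu : Function.update (prof i j) 0 (u !i) = prof (!i) j := Fin.update_cons_zero _ _ _
  have hv : Function.update (prof i j) 1 (v !j) = prof i (!j) := by
    funext k
    refine Fin.cases rfl (Fin.cases rfl fun k => ?_) k
    rw [Function.update_of_ne (by simp [Fin.ext_iff])]
    rfl
  have e₁ := hmin 0 (u !i) (Finset.mem_image_of_mem u (Finset.mem_univ _))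
  have e₂ := hmin 1 (v !j) (show v (!j) ∈ univ.image v from
    Finset.mem_image_of_mem v (Finset.mem_univ _))
  rw [hu, hcost₁, hcost₁] at e₁
  rw [hv, hcost₂, hcost₂] at e₂
  exact ⟨i, j, le_of_mul_le_mul_left e₁ (by exact_mod_cast hx),
    le_of_mul_le_mul_left e₂ (by exact_mod_cast hy)⟩

/-- The value of `d` at `t + x + y` is never strictly between those at `t + x` and `t + y`. -/
def NoStrictBetween (d : NNReal → ℝ) : Prop :=
  ∀ t x y : NNReal, 0 < x → 0 < y →
    (d (t + x + y) ≤ d (t + x) ∧ d (t + x + y) ≤ d (t + y)) ∨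
      (d (t + x) ≤ d (t + x + y) ∧ d (t + y) ≤ d (t + x + y))

theorem NoStrictBetween.neg {d : NNReal → ℝ} (h : NoStrictBetween d) : NoStrictBetween (-d) := by
  intro t x y hx hy
  simpa using (h t x y hx hy).symm

theorem noStrictBetween_int {𝒞 : WCostFamily} (hcomp : WClosedUnderComposition 𝒞)
    (hcons : WConsistent 𝒞) {m : ℕ} {c : (Fin m → NNReal) → Fin m → ℝ} (hc : c ∈ 𝒞 m)
    (S T : Finset (Fin m)) (z z₂ : Fin m → NNReal) (a b : ℤ) :
    NoStrictBetween fun lam => a * diagCost c S z lam + b * diagCost c T z₂ lam := by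
  intro t x y hx hy
  have hreal := Realizable.nsmul_add_nsmul hcomp hc S T (z + t • nindicVec S)
    (z₂ + t • nindicVec T) (fun p => if p.1 = p.2 then a.toNat else (-a).toNat)
    (fun p => if p.1 = p.2 then b.toNat else (-b).toNat)
  obtain ⟨i, j, h₁, h₂⟩ := hreal.exists_equilibrium hcons hx hy
  have ha : (a : ℝ) = (a.toNat : ℝ) - ((-a).toNat : ℝ) := by
    exact_mod_cast (Int.toNat_sub_toNat_neg a).symm
  have hb : (b : ℝ) = (b.toNat : ℝ) - ((-b).toNat : ℝ) := by
    exact_mod_cast (Int.toNat_sub_toNat_neg b).symm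
  simp only [nsmul_eq_mul, Pi.add_apply, Pi.mul_apply, Pi.natCast_apply, diagCost_add,
    ← add_assoc] at h₁ h₂
  beta_reduce
  rw [ha, hb]
  cases i <;> cases j <;> simp at h₁ h₂
  · left; constructor <;> linarith
  · right; constructor <;> linarith
  · right; constructor <;> linarith
  · left; constructor <;> linarith

theorem noStrictBetween_real {f g : NNReal → ℝ}
    (h : ∀ a b : ℤ, NoStrictBetween fun lam => a * f lam + b * g lam) (α β : ℝ) :
    NoStrictBetween fun lam => α * f lam + β * g lam := by
  intro t x y hx hy
  have hdense : DenseRange (Prod.map ((↑) : ℚ → ℝ) ((↑) : ℚ → ℝ)) :=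
    Rat.denseRange_cast.prodMap Rat.denseRange_cast
  refine hdense.induction_on (p := fun q : ℝ × ℝ =>
    (q.1 * f (t + x + y) + q.2 * g (t + x + y) ≤ q.1 * f (t + x) + q.2 * g (t + x) ∧
      q.1 * f (t + x + y) + q.2 * g (t + x + y) ≤ q.1 * f (t + y) + q.2 * g (t + y)) ∨
    (q.1 * f (t + x) + q.2 * g (t + x) ≤ q.1 * f (t + x + y) + q.2 * g (t + x + y) ∧
      q.1 * f (t + y) + q.2 * g (t + y) ≤ q.1 * f (t + x + y) + q.2 * g (t + x + y)))
    (α, β) ?_ ?_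
  · have hle : ∀ s s', IsClosed {q : ℝ × ℝ | q.1 * f s + q.2 * g s ≤ q.1 * f s' + q.2 * g s'} :=
      fun s s' => isClosed_le (by fun_prop) (by fun_prop)
    exact ((hle _ _).inter (hle _ _)).union ((hle _ _).inter (hle _ _))
  · rintro ⟨p, q⟩
    have hp : (0 : ℝ) < p.den := by exact_mod_cast p.den_pos
    have hq : (0 : ℝ) < q.den := by exact_mod_cast q.den_pos
    have hpq := mul_pos hp hq
    have hp' : (p : ℝ) * p.den = p.num := by exact_mod_cast p.mul_den_eq_num
    have hq' : (q : ℝ) * q.den = q.num := by exact_mod_cast q.mul_den_eq_num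
    have key : ∀ s, ((p.num * q.den : ℤ) : ℝ) * f s + ((q.num * p.den : ℤ) : ℝ) * g s =
        (p.den * q.den : ℝ) * (p * f s + q * g s) := by
      intro s
      push_cast
      rw [← hp', ← hq']
      ring
    have := h (p.num * q.den) (q.num * p.den) t x y hx hy
    simpa only [key, mul_le_mul_iff_right₀ hpq, Prod.map_apply] using this

theorem NoStrictBetween.not_peak {d : NNReal → ℝ} (hd : Continuous d) (h : NoStrictBetween d)
    {a b c : NNReal} (hab : a ≤ b) (hbc : b ≤ c) (hlt : d a < d b) (hlt' : d c < d b) : False := by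
  have hab : a < b := lt_of_le_of_ne hab (by rintro rfl; exact lt_irrefl _ hlt)
  obtain ⟨u, hu, hau, hub⟩ : ∃ u, d u < d b ∧ a < u ∧ u < b := by
    have h₁ : ∀ᶠ u in nhdsWithin a (Set.Ioi a), d u < d b :=
      (hd.tendsto a).mono_left nhdsWithin_le_nhds (Iio_mem_nhds hlt)
    have : (nhdsWithin a (Set.Ioi a)).NeBot := nhdsGT_neBot_of_exists_gt ⟨b, hab⟩
    obtain ⟨u, h, hu⟩ := (h₁.and (Ioo_mem_nhdsGT hab)).exists
    exact ⟨u, h, hu.1, hu.2⟩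
  have hcpt : IsCompact (Set.Icc b c ∩ {s | d b ≤ d s}) :=
    isCompact_Icc.inter_right (isClosed_le continuous_const hd)
  obtain ⟨v, ⟨⟨hbv, hvc⟩, hv⟩, hvmax⟩ := hcpt.exists_isGreatest ⟨b, ⟨le_rfl, hbc⟩, le_refl (d b)⟩
  simp only [Set.mem_ofPred_eq] at hv
  have hvc : v < c := lt_of_le_of_ne hvc (by rintro rfl; linarith)
  have hu0 : 0 < u := zero_le.trans_lt hau
  obtain ⟨s, hus, hvs, hs⟩ : ∃ s, d u < d s ∧ v < s ∧ s < min c (v + u) := by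
    have h₁ : ∀ᶠ s in nhdsWithin v (Set.Ioi v), d u < d s :=
      (hd.tendsto v).mono_left nhdsWithin_le_nhds (Ioi_mem_nhds (hu.trans_le hv))
    have : (nhdsWithin v (Set.Ioi v)).NeBot := nhdsGT_neBot_of_exists_gt ⟨c, hvc⟩
    obtain ⟨s, h, hs⟩ := (h₁.and (Ioo_mem_nhdsGT
      (lt_min hvc (lt_add_of_pos_right v hu0)))).exists
    exact ⟨s, h, hs.1, hs.2⟩
  have hsb : d s < d b := by
    by_contra hcon
    exact absurd (hvmax ⟨⟨hbv.trans hvs.le, (hs.trans_le (min_le_left _ _)).le⟩, not_lt.1 hcon⟩)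
      (not_le.2 hvs)
  obtain ⟨e, rfl⟩ := exists_add_of_le hvs.le
  have he : 0 < e := by simpa using hvs
  have heu : e < u := by simpa using hs.trans_le (min_le_right _ _)
  obtain ⟨t, rfl⟩ := exists_add_of_le heu.le
  have htv : t < v := (le_add_self).trans_lt (hub.trans_le hbv)
  obtain ⟨x, rfl⟩ := exists_add_of_le htv.le
  have hx : 0 < x := by simpa using htv
  rw [add_comm e t] at hus
  rcases h t x e hx he with ⟨-, h₂⟩ | ⟨h₁, -⟩ <;> linarith

theorem NoStrictBetween.monotone_or_antitone {d : NNReal → ℝ} (hd : Continuous d)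
    (h : NoStrictBetween d) : Monotone d ∨ Antitone d := by
  by_contra hcon
  rw [not_or] at hcon
  obtain ⟨a, b, c, hab, hbc, ⟨h₁, h₂⟩ | ⟨h₁, h₂⟩⟩ :=
    not_monotone_not_antitone_iff_exists_le_le.1 hcon
  · exact h.not_peak hd hab hbc h₁ h₂
  · exact h.neg.not_peak hd.neg hab hbc (neg_lt_neg h₁) (neg_lt_neg h₂)

theorem eq_of_monotone_or_antitone {d : NNReal → ℝ} (h : Monotone d ∨ Antitone d)
    {a b x : NNReal} (hab : d a = d b) (hax : a ≤ x) (hxb : x ≤ b) : d x = d a := by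
  rcases h with h | h
  · exact le_antisymm ((h hxb).trans_eq hab.symm) (h hax)
  · exact le_antisymm (h hax) (hab.trans_le (h hxb))

/-- If all linear combinations of `f` and `g` are monotone or antitone and `f` is not constant,
then `g` is an affine function of `f`. -/
theorem exists_affine_of_combinations_monotone {f g : NNReal → ℝ}
    (h : ∀ α β : ℝ, Monotone (fun s => α * f s + β * g s) ∨ Antitone (fun s => α * f s + β * g s))
    {x₁ : NNReal} (hx₁ : f x₁ ≠ f 0) : ∃ α β : ℝ, ∀ s, g s = α * f s + β := by
  have hf : Monotone f ∨ Antitone f := by simpa using h 1 0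
  have key : ∀ x, x₁ ≤ x → ∃ α : ℝ, ∀ s ≤ x, g s - g 0 = α * (f s - f 0) := by
    intro x hx
    have hne : f x - f 0 ≠ 0 := fun h0 =>
      hx₁ (eq_of_monotone_or_antitone hf (sub_eq_zero.1 h0).symm zero_le hx)
    refine ⟨(g x - g 0) / (f x - f 0), fun s hs => ?_⟩
    have := eq_of_monotone_or_antitone (h (-((g x - g 0) / (f x - f 0))) 1) (a := 0) (b := x)
      (by field_simp; ring) zero_le hs
    linarith
  obtain ⟨α, hα⟩ := key x₁ le_rfl
  refine ⟨α, g 0 - α * f 0, fun s => ?_⟩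
  obtain ⟨α', hα'⟩ := key (max x₁ s) (le_max_left _ _)
  have hαα' : α = α' := by
    have h₁ := hα x₁ le_rfl
    rw [hα' x₁ (le_max_left _ _)] at h₁
    exact (mul_right_cancel₀ (sub_ne_zero.2 hx₁) h₁).symm
  have := hα' s (le_max_right _ _)
  rw [← hαα'] at this
  linarith

theorem NNReal.exists_eq_mul_of_continuous_additive {F : NNReal → ℝ} (hF : Continuous F)
    (hadd : ∀ x y, F (x + y) = F x + F y) : ∃ a : ℝ, ∀ x, F x = a * x := by
  let G : ℝ → ℝ := fun x => F x.toNNReal - F (-x).toNNReal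
  have hG : ∀ p q : NNReal, G (p - q) = F p - F q := by
    intro p q
    have hpq : ((p : ℝ) - q).toNNReal + q = p + (-((p : ℝ) - q)).toNNReal := by
      apply NNReal.coe_injective
      push_cast
      have := max_zero_sub_max_neg_zero_eq_self ((p : ℝ) - q)
      simp only [Real.coe_toNNReal']
      linarith
    have := congrArg F hpq
    rw [hadd, hadd] at this
    simp only [G]
    linarith
  have hGadd : ∀ x y, G (x + y) = G x + G y := by
    intro x y
    obtain ⟨p, q, rfl⟩ : ∃ p q : NNReal, x = p - q :=
      ⟨x.toNNReal, (-x).toNNReal, by simp [Real.coe_toNNReal']⟩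
    obtain ⟨p', q', rfl⟩ : ∃ p q : NNReal, y = p - q :=
      ⟨y.toNNReal, (-y).toNNReal, by simp [Real.coe_toNNReal']⟩
    have : (p : ℝ) - q + (p' - q') = ((p + p' : NNReal) : ℝ) - ((q + q' : NNReal) : ℝ) := by
      push_cast; ring
    rw [this, hG, hG, hG, hadd, hadd]
    ring
  have hGcont : Continuous G := by fun_prop
  let L := (AddMonoidHom.mk' G hGadd).toRealLinearMap hGcont
  refine ⟨G 1, fun x => ?_⟩
  have h0 : F 0 = 0 := by simpa using hadd 0 0
  have h₁ : G x = F x := by simpa [h0] using hG x 0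
  have h₂ : L ((x : ℝ) • (1 : ℝ)) = (x : ℝ) • L 1 := map_smul L _ _
  have h₃ : G ((x : ℝ) • (1 : ℝ)) = (x : ℝ) • G 1 := h₂
  rw [smul_eq_mul, smul_eq_mul, mul_one, h₁] at h₃
  rw [h₃, mul_comm]

theorem NNReal.exists_eq_exp_of_continuous_multiplicative {F : NNReal → ℝ} (hF : Continuous F)
    (h0 : F 0 = 1) (hmul : ∀ x y, F (x + y) = F x * F y) :
    ∃ φ : ℝ, ∀ x : NNReal, F x = Real.exp (φ * x) := by
  have hsq : ∀ x, F x = F (x / 2) ^ 2 := fun x => by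
    rw [sq, ← hmul, add_halves]
  have hne : ∀ x, F x ≠ 0 := by
    intro x hx
    have hn : ∀ n : ℕ, F (x * (1 / 2) ^ n) = 0 := by
      intro n
      induction n with
      | zero => simpa using hx
      | succ n ih =>
        rw [hsq] at ih
        rw [pow_succ, ← mul_assoc, mul_one_div]
        exact pow_eq_zero_iff two_ne_zero |>.1 ih
    have hlim : Filter.Tendsto (fun n : ℕ => F (x * (1 / 2) ^ n)) Filter.atTop (nhds (F 0)) := by
      refine (hF.tendsto 0).comp ?_
      have h₁ : Filter.Tendsto (fun n : ℕ => (1 / 2 : NNReal) ^ n) Filter.atTop (nhds 0) :=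
        NNReal.tendsto_pow_atTop_nhds_zero_of_lt_one
          (by simpa using NNReal.half_lt_self one_ne_zero)
      simpa using h₁.const_mul x
    simp only [hn, h0] at hlim
    exact zero_ne_one (tendsto_nhds_unique tendsto_const_nhds hlim)
  have hpos : ∀ x, 0 < F x := fun x => lt_of_le_of_ne (hsq x ▸ sq_nonneg _) (hne x).symm
  obtain ⟨φ, hφ⟩ := NNReal.exists_eq_mul_of_continuous_additive (hF.log hne)
    (fun x y => by rw [hmul, Real.log_mul (hne x) (hne y)])
  exact ⟨φ, fun x => by rw [← hφ, Real.exp_log (hpos x)]⟩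

/-- A continuous nonconstant function all of whose translates are affine functions of itself is
affine or an affine function of an exponential. -/
theorem affine_or_exp_of_translates {f : NNReal → ℝ} (hf : Continuous f) {x₁ : NNReal}
    (hx₁ : f x₁ ≠ f 0) (h : ∀ t, ∃ α β : ℝ, ∀ s, f (t + s) = α * f s + β) :
    (∃ a b : ℝ, ∀ s : NNReal, f s = a * s + b) ∨
      ∃ φ a b : ℝ, ∀ s : NNReal, f s = a * Real.exp (φ * s) + b := by
  choose A B hAB using h
  have hx₁' := sub_ne_zero.2 hx₁
  have hA : ∀ t s, f (t + s) - f 0 = A t * (f s - f 0) + (f t - f 0) := by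
    intro t s
    have := hAB t 0
    rw [add_zero] at this
    rw [hAB t s, this]
    ring
  have hAeq : A = fun t => (f (t + x₁) - f t) / (f x₁ - f 0) := by
    funext t
    rw [eq_div_iff hx₁']
    linarith [hA t x₁]
  have hAcont : Continuous A := by
    rw [hAeq]
    fun_prop
  by_cases hA1 : ∀ t, A t = 1
  · left
    obtain ⟨a, ha⟩ := NNReal.exists_eq_mul_of_continuous_additive
      (F := fun s => f s - f 0) (by fun_prop) (fun x y => by rw [hA, hA1]; ring)
    exact ⟨a, f 0, fun s => by linarith [ha s]⟩
  · right
    push Not at hA1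
    obtain ⟨t₀, ht₀⟩ := hA1
    have ht₀' := sub_ne_zero.2 ht₀
    set K := (f t₀ - f 0) / (A t₀ - 1) with hK
    have hfK : ∀ s, f s - f 0 = K * (A s - 1) := by
      intro s
      have h₁ := hA t₀ s
      rw [add_comm, hA s t₀] at h₁
      rw [hK, div_mul_eq_mul_div, eq_div_iff ht₀']
      linarith
    have hK0 : K ≠ 0 := by
      intro h0
      have := hfK x₁
      rw [h0, zero_mul] at this
      exact hx₁' this
    have hmul : ∀ x y, A (x + y) = A x * A y := by
      intro x y
      have h₁ := hA x y
      rw [hfK, hfK, hfK] at h₁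
      exact mul_left_cancel₀ hK0 (by linarith)
    have h0 : A 0 = 1 := by
      have := hfK 0
      rw [sub_self, eq_comm, mul_eq_zero] at this
      exact sub_eq_zero.1 (this.resolve_left hK0)
    obtain ⟨φ, hφ⟩ := NNReal.exists_eq_exp_of_continuous_multiplicative hAcont h0 hmul
    exact ⟨φ, K, f 0 - K, fun s => by rw [← hφ]; linarith [hfK s]⟩

/-- Lemma: for any member of a consistent, composition-closed set of continuous cost
functions, the aggregated cost along any diagonal direction `1_S` is affine or exponential. -/
theorem weighted_congestion_separable (𝒞 : WCostFamily)
    (hcont : ∀ m : ℕ, ∀ c ∈ 𝒞 m, Continuous c)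
    (hcomp : WClosedUnderComposition 𝒞) (hcons : WConsistent 𝒞)
    (m : ℕ) (c : (Fin m → NNReal) → Fin m → ℝ) (hc : c ∈ 𝒞 m) :
    (∀ S : Finset (Fin m), ∀ z : Fin m → NNReal, ∃ a b : ℝ,
        ∀ lam : NNReal, ∑ r ∈ S, c (z + lam • nindicVec S) r = a * (lam : ℝ) + b) ∨
      (∃ φ : ℝ, ∀ S : Finset (Fin m), ∀ z : Fin m → NNReal, ∃ a b : ℝ,
        ∀ lam : NNReal,
          ∑ r ∈ S, c (z + lam • nindicVec S) r = a * Real.exp (φ * (lam : ℝ)) + b) := by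
  have haff : ∀ (S T : Finset (Fin m)) (z z' : Fin m → NNReal) (x₁ : NNReal),
      diagCost c S z x₁ ≠ diagCost c S z 0 →
      ∃ α β : ℝ, ∀ s, diagCost c T z' s = α * diagCost c S z s + β := by
    intro S T z z' x₁ hx₁
    refine exists_affine_of_combinations_monotone (fun α β => ?_) hx₁
    have h₁ := continuous_diagCost (hcont m c hc) S z
    have h₂ := continuous_diagCost (hcont m c hc) T z'
    exact (noStrictBetween_real (noStrictBetween_int hcomp hcons hc S T z z')
      α β).monotone_or_antitone (by fun_prop)
  by_cases hconst : ∀ (S : Finset (Fin m)) (z : Fin m → NNReal) (x : NNReal),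
      diagCost c S z x = diagCost c S z 0
  · exact Or.inl fun S z => ⟨0, diagCost c S z 0, fun lam => by
      rw [zero_mul, zero_add]; exact hconst S z lam⟩
  push Not at hconst
  obtain ⟨S₀, z₀, x₁, hx₁⟩ := hconst
  have htrans : ∀ t, ∃ α β : ℝ, ∀ s,
      diagCost c S₀ z₀ (t + s) = α * diagCost c S₀ z₀ s + β := by
    intro t
    simpa only [diagCost_add] using haff S₀ S₀ z₀ (z₀ + t • nindicVec S₀) x₁ hx₁
  rcases affine_or_exp_of_translates (continuous_diagCost (hcont m c hc) S₀ z₀) hx₁ htrans with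
    ⟨a, b, hab⟩ | ⟨φ, a, b, hab⟩
  · refine Or.inl fun S z => ?_
    obtain ⟨α, β, h⟩ := haff S₀ S z₀ z x₁ hx₁
    refine ⟨α * a, α * b + β, fun lam => (h lam).trans ?_⟩
    rw [hab]
    ring
  · refine Or.inr ⟨φ, fun S z => ?_⟩
    obtain ⟨α, β, h⟩ := haff S₀ S z₀ z x₁ hx₁
    refine ⟨α * a, α * b + β, fun lam => (h lam).trans ?_⟩
    rw [hab]
    ring
end
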